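/- arXiv:1806.07499 — 12 statements merged into one kernel-verified Lean document; each statement's English description precedes it below -/
import Mathlib

section
/- There exists exactly one pair (y*, η*) with y* ∈ (0, 1) and η* ∈ (1, ∞) satisfying the system (S); moreover, this unique solution satisfies η* > 1/(1 − p). -/
open Real Set

noncomputable section

/-- The system (S) of two equations in the unknowns `y` and `η`. -/
def SystemS (κ δ p α y η : ℝ) : Prop :=
  α * Real.log η - Real.log y + α / (η * (1 - p)) - 1 / y = α * (1 + p) - 1 ∧
  α ^ (1 - p * (1 + κ * δ)) * (p * (1 + κ * δ) - 1) *
      (κ * η ^ (1 + κ * δ) / (1 + κ * δ) - η ^ (κ * δ) / (δ * (1 - p))) +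
    (κ * y ^ (1 + κ * δ) / (1 + κ * δ) - y ^ (κ * δ) / δ) =
  (α ^ (1 - p * (1 + κ * δ)) - 1) / (δ * (1 + κ * δ))

def C1 (κ δ p α η : ℝ) : ℝ :=
  -(κ * α / (1 + κ * δ)) *
    (Real.log η - p * Real.log α + 1 / (η * (1 - p)) + 1 / (1 + κ * δ))

def C2 (κ δ p α η : ℝ) : ℝ :=
  α ^ (1 - p * (1 + κ * δ)) / (1 + κ * δ) *
    (κ * η ^ (1 + κ * δ) / (1 + κ * δ) - η ^ (κ * δ) / (δ * (1 - p)))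

def C3 (κ δ p α η : ℝ) : ℝ :=
  -(κ * α / (1 + κ * δ)) * (Real.log η + 1 / (η * (1 - p)) - (1 + p))

def C4 (κ δ p α η : ℝ) : ℝ :=
  α ^ (1 - p * (1 + κ * δ)) / (1 + κ * δ) *
    (κ * η ^ (1 + κ * δ) / (1 + κ * δ) - η ^ (κ * δ) / (δ * (1 - p)) -
      1 / (δ * (1 + κ * δ) * (p * (1 + κ * δ) - 1)))

def C5 (κ δ p α η : ℝ) : ℝ :=
  -(κ / (1 + κ * δ)) *
    (α * Real.log η + α / (η * (1 - p)) + (1 - α) * (1 + p) + 1 / (1 + κ * δ))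

def C6 (κ δ p α η : ℝ) : ℝ :=
  C2 κ δ p α η -
    (α ^ (1 - p * (1 + κ * δ)) - 1) / (δ * (1 + κ * δ) ^ 2 * (p * (1 + κ * δ) - 1))

/-- The dual function `Û`, defined piecewise (here `η` stands for `η*`). -/
def Uhat (κ δ p α η : ℝ) (y : ℝ) : ℝ :=
  if α ^ (-p) ≤ y then
    C1 κ δ p α η * y + C2 κ δ p α η * y ^ (-(κ * δ)) +
      κ * α / (1 + κ * δ) * (y * Real.log y) + α ^ (1 - p) / (δ * (1 - p))
  else if 1 < y then
    C3 κ δ p α η * y + C4 κ δ p α η * y ^ (-(κ * δ)) +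
      κ * p ^ 3 / ((1 - p) * (p * (1 + κ * δ) - 1)) * y ^ (-(1 - p) / p)
  else
    C5 κ δ p α η * y + C6 κ δ p α η * y ^ (-(κ * δ)) +
      κ / (1 + κ * δ) * (y * Real.log y) + 1 / (δ * (1 - p))

/-- The function `log x + b / x`, which decreases up to `b` and increases afterwards. -/
def logAddDiv (b x : ℝ) : ℝ := Real.log x + b / x

/-- The function `c x ^ (1 + c) / (1 + c) - b x ^ c`, whose derivative is `c x ^ (c - 1) (x - b)`. -/
def powDiff (c b x : ℝ) : ℝ := c * x ^ (1 + c) / (1 + c) - b * x ^ c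

lemma hasDerivAt_logAddDiv {x : ℝ} (b : ℝ) (hx : 0 < x) :
    HasDerivAt (logAddDiv b) ((x - b) / x ^ 2) x := by
  have h := (Real.hasDerivAt_log hx.ne').add ((hasDerivAt_const x b).div (hasDerivAt_id x) hx.ne')
  refine h.congr_deriv ?_
  simp only [id]
  field_simp
  ring

lemma hasDerivAt_powDiff {c x : ℝ} (b : ℝ) (hc : 0 < c) (hx : 0 < x) :
    HasDerivAt (powDiff c b) (c * x ^ (c - 1) * (x - b)) x := by
  have h1 := Real.hasDerivAt_rpow_const (p := 1 + c) (Or.inl hx.ne')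
  have h2 := Real.hasDerivAt_rpow_const (p := c) (Or.inl hx.ne')
  have h := ((h1.const_mul c).div_const (1 + c)).sub (h2.const_mul b)
  refine h.congr_deriv ?_
  have e : x ^ (1 + c - 1) = x ^ (c - 1) * x := by
    rw [← Real.rpow_add_one hx.ne']; ring_nf
  rw [e]
  field_simp

lemma continuousOn_logAddDiv (b : ℝ) : ContinuousOn (logAddDiv b) (Ioi 0) := fun _ hx =>
  (hasDerivAt_logAddDiv b hx).continuousAt.continuousWithinAt

lemma continuousOn_powDiff {c : ℝ} (b : ℝ) (hc : 0 < c) : ContinuousOn (powDiff c b) (Ioi 0) :=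
  fun _ hx => (hasDerivAt_powDiff b hc hx).continuousAt.continuousWithinAt

lemma strictMonoOn_logAddDiv {b : ℝ} (hb : 0 < b) : StrictMonoOn (logAddDiv b) (Ici b) := by
  refine strictMonoOn_of_deriv_pos (convex_Ici b)
    ((continuousOn_logAddDiv b).mono fun x hx => hb.trans_le hx) fun x hx => ?_
  rw [interior_Ici, mem_Ioi] at hx
  have hx0 := hb.trans hx
  rw [(hasDerivAt_logAddDiv b hx0).deriv]
  exact div_pos (sub_pos.2 hx) (by positivity)

lemma strictAntiOn_logAddDiv (b : ℝ) : StrictAntiOn (logAddDiv b) (Ioc 0 b) := by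
  refine strictAntiOn_of_deriv_neg (convex_Ioc 0 b)
    ((continuousOn_logAddDiv b).mono fun x hx => hx.1) fun x hx => ?_
  rw [interior_Ioc] at hx
  have hx0 := hx.1
  rw [(hasDerivAt_logAddDiv b hx0).deriv]
  exact div_neg_of_neg_of_pos (sub_neg.2 hx.2) (by positivity)

lemma strictMonoOn_powDiff {b c : ℝ} (hc : 0 < c) (hb : 0 < b) :
    StrictMonoOn (powDiff c b) (Ici b) := by
  refine strictMonoOn_of_deriv_pos (convex_Ici b)
    ((continuousOn_powDiff b hc).mono fun x hx => hb.trans_le hx) fun x hx => ?_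
  rw [interior_Ici, mem_Ioi] at hx
  have hx0 := hb.trans hx
  rw [(hasDerivAt_powDiff b hc hx0).deriv]
  exact mul_pos (by positivity) (sub_pos.2 hx)

lemma strictAntiOn_powDiff {c : ℝ} (b : ℝ) (hc : 0 < c) :
    StrictAntiOn (powDiff c b) (Ioc 0 b) := by
  refine strictAntiOn_of_deriv_neg (convex_Ioc 0 b)
    ((continuousOn_powDiff b hc).mono fun x hx => hx.1) fun x hx => ?_
  rw [interior_Ioc] at hx
  have hx0 := hx.1
  rw [(hasDerivAt_powDiff b hc hx0).deriv]
  exact mul_neg_of_pos_of_neg (by positivity) (sub_neg.2 hx.2)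

lemma powDiff_eq_rpow_mul {c x : ℝ} (b : ℝ) (hx : 0 < x) :
    powDiff c b x = x ^ c * (c * x / (1 + c) - b) := by
  rw [powDiff, Real.rpow_add hx, Real.rpow_one]
  ring

lemma powDiff_neg {b c x : ℝ} (hc : 0 < c) (hx : 0 < x) (hxb : x ≤ b) : powDiff c b x < 0 := by
  rw [powDiff_eq_rpow_mul b hx]
  refine mul_neg_of_pos_of_neg (by positivity) ?_
  rw [sub_neg, div_lt_iff₀ (by positivity)]
  nlinarith

lemma neg_one_div_lt_powDiff_one {c y : ℝ} (hc : 0 < c) (hy : y ∈ Ioo (0 : ℝ) 1) :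
    -(1 / (1 + c)) < powDiff c 1 y := by
  have h := strictAntiOn_powDiff 1 hc ⟨hy.1, hy.2.le⟩ ⟨one_pos, le_rfl⟩ hy.2
  have e : powDiff c 1 1 = -(1 / (1 + c)) := by
    simp only [powDiff, Real.one_rpow]
    field_simp
    ring
  rwa [e] at h

/-- The minimum of `log x + b / x` for `b = 1 / (1 - p)` exceeds `1 + p`. -/
lemma one_add_lt_logAddDiv {p x : ℝ} (hp0 : 0 < p) (hp : p < 1) (hx : 0 < x) :
    1 + p < logAddDiv (1 / (1 - p)) x := by
  have hb : 0 < 1 / (1 - p) := by have := sub_pos.2 hp; positivity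
  have hmin : 1 + p < logAddDiv (1 / (1 - p)) (1 / (1 - p)) := by
    have h := Real.log_lt_sub_one_of_pos (sub_pos.2 hp) (by linarith)
    rw [logAddDiv, div_self hb.ne', one_div, Real.log_inv]
    linarith
  rcases le_total x (1 / (1 - p)) with h | h
  · exact hmin.trans_le ((strictAntiOn_logAddDiv _).antitoneOn ⟨hx, h⟩ ⟨hb, le_rfl⟩ h)
  · exact hmin.trans_le ((strictMonoOn_logAddDiv hb).monotoneOn self_mem_Ici h h)

/-- The function `exp s - s - 1` on `[0, ∞)`, continued by the identity to an increasing
bijection of the real line. -/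
def expExcess (s : ℝ) : ℝ := Real.exp (max s 0) - max s 0 - 1 + min s 0

lemma expExcess_of_nonneg {s : ℝ} (hs : 0 ≤ s) : expExcess s = Real.exp s - s - 1 := by
  simp [expExcess, hs]

lemma expExcess_of_nonpos {s : ℝ} (hs : s ≤ 0) : expExcess s = s := by
  simp [expExcess, hs]

lemma continuous_expExcess : Continuous expExcess := by
  unfold expExcess
  fun_prop

lemma strictMono_expExcess : StrictMono expExcess := by
  have h1 : StrictMonoOn expExcess (Iic 0) := fun s hs t ht hst => by
    rwa [expExcess_of_nonpos hs, expExcess_of_nonpos ht]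
  have h2 : StrictMonoOn expExcess (Ici 0) := fun s hs t ht hst => by
    rw [expExcess_of_nonneg hs, expExcess_of_nonneg ht]
    have hs1 : 1 ≤ Real.exp s := Real.one_le_exp hs
    have h := Real.add_one_lt_exp (sub_pos.2 hst).ne'
    have e : Real.exp t = Real.exp s * Real.exp (t - s) := by rw [← Real.exp_add]; ring_nf
    rw [e]
    nlinarith
  exact h1.Iic_union_Ici h2

lemma surjective_expExcess : Function.Surjective expExcess := by
  refine continuous_expExcess.surjective ?_ ?_
  · refine Filter.tendsto_atTop_mono' _ ?_
      (Filter.tendsto_id.atTop_add (tendsto_const_nhds (x := -2)))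
    filter_upwards [Filter.eventually_ge_atTop 0] with s hs
    rw [expExcess_of_nonneg hs]
    have h := Real.quadratic_le_exp_of_nonneg hs
    simp only [id]
    nlinarith [sq_nonneg (s - 1)]
  · refine Filter.tendsto_id.congr' ?_
    filter_upwards [Filter.eventually_le_atBot 0] with s hs
    rw [expExcess_of_nonpos hs, id]

/-- `expExcess` as an order isomorphism of the real line. -/
def expExcessIso : ℝ ≃o ℝ :=
  strictMono_expExcess.orderIsoOfSurjective expExcess surjective_expExcess

/-- The solution `y ∈ (0, 1)` of `log y + 1 / y = 1 + v`, for `v > 0`. -/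
def logAddInvSolution (v : ℝ) : ℝ := Real.exp (-expExcessIso.symm v)

lemma continuous_logAddInvSolution : Continuous logAddInvSolution :=
  Real.continuous_exp.comp expExcessIso.symm.continuous.neg

lemma logAddInvSolution_spec {v : ℝ} (hv : 0 < v) :
    logAddInvSolution v ∈ Ioo (0 : ℝ) 1 ∧ logAddDiv 1 (logAddInvSolution v) = 1 + v := by
  set s := expExcessIso.symm v with hs
  have hsv : expExcess s = v := expExcessIso.apply_symm_apply v
  have hs0 : 0 < s := by
    by_contra! h
    rw [expExcess_of_nonpos h] at hsv
    linarith
  rw [expExcess_of_nonneg hs0.le] at hsv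
  refine ⟨⟨Real.exp_pos _, Real.exp_lt_one_iff.2 (neg_neg_of_pos hs0)⟩, ?_⟩
  rw [logAddDiv, logAddInvSolution, Real.log_exp, ← hs, Real.exp_neg, one_div, inv_inv]
  linarith

lemma systemS_iff {κ δ p α y η : ℝ} (hδ : 0 < δ) (hc : 0 < κ * δ) (hp : p < 1) :
    SystemS κ δ p α y η ↔
      logAddDiv 1 y = 1 + α * (logAddDiv (1 / (1 - p)) η - (1 + p)) ∧
      α ^ (1 - p * (1 + κ * δ)) * (p * (1 + κ * δ) - 1) * powDiff (κ * δ) (1 / (1 - p)) η +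
        powDiff (κ * δ) 1 y = (α ^ (1 - p * (1 + κ * δ)) - 1) / (1 + κ * δ) := by
  have hp' : 1 - p ≠ 0 := (sub_pos.2 hp).ne'
  have hk : 1 + κ * δ ≠ 0 := by positivity
  refine and_congr ?_ ?_
  · have e : α / (η * (1 - p)) = α * (1 / (1 - p) / η) := by
      rw [div_div, mul_comm η, mul_one_div]
    rw [e, logAddDiv, logAddDiv]
    constructor <;> intro h <;> linarith
  · have e1 : κ * η ^ (1 + κ * δ) / (1 + κ * δ) - η ^ (κ * δ) / (δ * (1 - p)) =
        powDiff (κ * δ) (1 / (1 - p)) η / δ := by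
      rw [powDiff]; field_simp
    have e2 : κ * y ^ (1 + κ * δ) / (1 + κ * δ) - y ^ (κ * δ) / δ = powDiff (κ * δ) 1 y / δ := by
      rw [powDiff]; field_simp
    rw [e1, e2, mul_comm δ, ← div_div, ← mul_div_assoc, ← add_div, div_left_inj' (ne_of_gt hδ)]

/-- A solution of the reduced system has `η` beyond the minimum point `b`. -/
lemma lt_of_powDiff_add_eq {c b B R y η : ℝ} (hc : 0 < c) (hB : 0 < B) (hR : 0 < R)
    (hy : y ∈ Ioo (0 : ℝ) 1) (hη : 0 < η)
    (h : B * powDiff c b η + powDiff c 1 y = R) : b < η := by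
  by_contra! hle
  have h1 := mul_neg_of_pos_of_neg hB (powDiff_neg hc hη hle)
  have h2 := powDiff_neg hc hy.1 hy.2.le
  linarith

/-- On the branch `η ≥ b`, a larger `η` corresponds to a smaller `y`, so the left-hand side of the
second equation increases. -/
lemma powDiff_add_lt {c b α B m y₁ y₂ η₁ η₂ : ℝ} (hc : 0 < c) (hb : 0 < b) (hα : 0 < α)
    (hB : 0 < B) (hy₁ : y₁ ∈ Ioo (0 : ℝ) 1) (hy₂ : y₂ ∈ Ioo (0 : ℝ) 1) (hη₁ : b ≤ η₁)
    (hlt : η₁ < η₂) (h₁ : logAddDiv 1 y₁ = 1 + α * (logAddDiv b η₁ - m))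
    (h₂ : logAddDiv 1 y₂ = 1 + α * (logAddDiv b η₂ - m)) :
    B * powDiff c b η₁ + powDiff c 1 y₁ < B * powDiff c b η₂ + powDiff c 1 y₂ := by
  have hη₂ : b ≤ η₂ := hη₁.trans hlt.le
  have hy₁' : y₁ ∈ Ioc (0 : ℝ) 1 := ⟨hy₁.1, hy₁.2.le⟩
  have hy₂' : y₂ ∈ Ioc (0 : ℝ) 1 := ⟨hy₂.1, hy₂.2.le⟩
  have hl := strictMonoOn_logAddDiv hb hη₁ hη₂ hlt
  have hy : y₂ < y₁ := by
    rw [← (strictAntiOn_logAddDiv 1).lt_iff_gt hy₁' hy₂', h₁, h₂]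
    gcongr
  have hΨ := strictAntiOn_powDiff 1 hc hy₂' hy₁' hy
  have hΦ := strictMonoOn_powDiff hc hb hη₁ hη₂ hlt
  gcongr

lemma exists_reduced_solution {c p α A : ℝ} (hc : 0 < c) (hp0 : 0 < p) (hp : p < 1)
    (hα : 0 < α) (hA : 1 < A) (hk : 0 < p * (1 + c) - 1) :
    ∃ y η : ℝ, y ∈ Ioo (0 : ℝ) 1 ∧ 1 / (1 - p) ≤ η ∧
      logAddDiv 1 y = 1 + α * (logAddDiv (1 / (1 - p)) η - (1 + p)) ∧
      A * (p * (1 + c) - 1) * powDiff c (1 / (1 - p)) η + powDiff c 1 y = (A - 1) / (1 + c) := by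
  set b := 1 / (1 - p) with hbdef
  set B := A * (p * (1 + c) - 1) with hBdef
  have hb1 : 1 < b := by rw [hbdef, lt_div_iff₀ (sub_pos.2 hp)]; linarith
  have hb : 0 < b := by linarith
  have hA0 : 0 < A := by linarith
  have hB : 0 < B := mul_pos hA0 hk
  set Y : ℝ → ℝ := fun η => logAddInvSolution (α * (logAddDiv b η - (1 + p))) with hY
  have hYs : ∀ η, 0 < η → Y η ∈ Ioo (0 : ℝ) 1 ∧
      logAddDiv 1 (Y η) = 1 + α * (logAddDiv b η - (1 + p)) := fun η hη =>
    logAddInvSolution_spec (mul_pos hα (sub_pos.2 (one_add_lt_logAddDiv hp0 hp hη)))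
  have hYc : ContinuousOn Y (Ioi 0) := continuous_logAddInvSolution.comp_continuousOn
    (continuousOn_const.mul ((continuousOn_logAddDiv b).sub continuousOn_const))
  have hTc : ContinuousOn (fun η => B * powDiff c b η + powDiff c 1 (Y η)) (Ioi 0) :=
    (continuousOn_const.mul (continuousOn_powDiff b hc)).add
      ((continuousOn_powDiff 1 hc).comp hYc fun η hη => (hYs η hη).1.1)
  set M := (1 + c) / c * (b + 1 / ((1 + c) * (p * (1 + c) - 1))) with hM
  have hbM : b ≤ M := by
    have h1 : 1 ≤ (1 + c) / c := by rw [le_div_iff₀ hc]; linarith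
    have h2 : 0 < 1 / ((1 + c) * (p * (1 + c) - 1)) := by positivity
    nlinarith
  have hM0 : 0 < M := by linarith
  have hlow : B * powDiff c b b + powDiff c 1 (Y b) ≤ (A - 1) / (1 + c) := by
    have h1 := mul_neg_of_pos_of_neg hB (powDiff_neg hc hb le_rfl)
    have h2 := powDiff_neg hc (hYs b hb).1.1 (hYs b hb).1.2.le
    have h3 : 0 < (A - 1) / (1 + c) := div_pos (sub_pos.2 hA) (by positivity)
    linarith
  have hhigh : (A - 1) / (1 + c) ≤ B * powDiff c b M + powDiff c 1 (Y M) := by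
    have h1 := neg_one_div_lt_powDiff_one hc (hYs M hM0).1
    have h2 : 1 / ((1 + c) * (p * (1 + c) - 1)) ≤ powDiff c b M := by
      have e : c * M / (1 + c) - b = 1 / ((1 + c) * (p * (1 + c) - 1)) := by
        rw [hM]; field_simp; ring
      rw [powDiff_eq_rpow_mul b hM0, e]
      exact le_mul_of_one_le_left (by positivity) (Real.one_le_rpow (by linarith) hc.le)
    have h3 : A / (1 + c) ≤ B * powDiff c b M := by
      refine le_trans (le_of_eq ?_) (mul_le_mul_of_nonneg_left h2 hB.le)
      rw [hBdef, mul_one_div, mul_div_mul_right _ _ hk.ne']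
    rw [sub_div]
    linarith
  obtain ⟨η, hη, hTη⟩ := intermediate_value_Icc hbM
    (hTc.mono fun x hx => hb.trans_le hx.1) ⟨hlow, hhigh⟩
  have hη0 : 0 < η := hb.trans_le hη.1
  exact ⟨Y η, η, (hYs η hη0).1, hη.1, (hYs η hη0).2, hTη⟩

theorem stmt0 (μ σ δ p α κ : ℝ)
    (hμ : 0 < μ) (hσ : 0 < σ) (hδ : 0 < δ) (hκ : κ = 2 * σ ^ 2 / μ ^ 2)
    (hα : α ∈ Set.Ioo (0 : ℝ) 1) (hp1 : 1 / (1 + κ * δ) < p) (hp2 : p < 1) :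
    (∃! q : ℝ × ℝ,
        q.1 ∈ Set.Ioo (0 : ℝ) 1 ∧ 1 < q.2 ∧ SystemS κ δ p α q.1 q.2) ∧
      ∀ q : ℝ × ℝ,
        q.1 ∈ Set.Ioo (0 : ℝ) 1 ∧ 1 < q.2 ∧ SystemS κ δ p α q.1 q.2 →
          1 / (1 - p) < q.2 := by
  have hκ0 : 0 < κ := by rw [hκ]; positivity
  have hc : 0 < κ * δ := mul_pos hκ0 hδ
  have hp0 : 0 < p := lt_trans (by positivity) hp1
  have hk : 0 < p * (1 + κ * δ) - 1 := by
    rw [div_lt_iff₀ (by positivity)] at hp1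
    linarith
  have hA : 1 < α ^ (1 - p * (1 + κ * δ)) :=
    Real.one_lt_rpow_of_pos_of_lt_one_of_neg hα.1 hα.2 (by linarith)
  have hB : 0 < α ^ (1 - p * (1 + κ * δ)) * (p * (1 + κ * δ) - 1) := mul_pos (by linarith) hk
  have hR : 0 < (α ^ (1 - p * (1 + κ * δ)) - 1) / (1 + κ * δ) :=
    div_pos (sub_pos.2 hA) (by positivity)
  have hb1 : 1 < 1 / (1 - p) := by rw [lt_div_iff₀ (sub_pos.2 hp2)]; linarith
  have hb : 0 < 1 / (1 - p) := by linarith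
  have hlarge : ∀ q : ℝ × ℝ, q.1 ∈ Set.Ioo (0 : ℝ) 1 ∧ 1 < q.2 ∧ SystemS κ δ p α q.1 q.2 →
      1 / (1 - p) < q.2 := fun q ⟨hy, hη, hS⟩ =>
    lt_of_powDiff_add_eq hc hB hR hy (by linarith) ((systemS_iff hδ hc hp2).1 hS).2
  refine ⟨existsUnique_of_exists_of_unique ?_ ?_, hlarge⟩
  · obtain ⟨y, η, hy, hη, h1, h2⟩ := exists_reduced_solution hc hp0 hp2 hα.1 hA hk
    exact ⟨(y, η), hy, hb1.trans_le hη, (systemS_iff hδ hc hp2).2 ⟨h1, h2⟩⟩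
  · intro q r hq hr
    obtain ⟨hq1, hq2⟩ := (systemS_iff hδ hc hp2).1 hq.2.2
    obtain ⟨hr1, hr2⟩ := (systemS_iff hδ hc hp2).1 hr.2.2
    have hη : q.2 = r.2 := by
      rcases lt_trichotomy q.2 r.2 with h | h | h
      · have := powDiff_add_lt hc hb hα.1 hB hq.1 hr.1 (hlarge q hq).le h hq1 hr1
        linarith
      · exact h
      · have := powDiff_add_lt hc hb hα.1 hB hr.1 hq.1 (hlarge r hr).le h hr1 hq1
        linarith
    refine Prod.ext ((strictAntiOn_logAddDiv 1).injOn ⟨hq.1.1, hq.1.2.le⟩ ⟨hr.1.1, hr.1.2.le⟩ ?_) hη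
    rw [hq1, hr1, hη]

end
end

section
/- The equation κ·η^{1+κδ}/(1 + κδ) − η^{κδ}/(δ(1 − p)) = (1 − α^{p(1+κδ)−1})/(δ(1 + κδ)(p(1 + κδ) − 1)) in the unknown η has exactly one solution in the interval (1, ∞), and this solution is greater than 1/(1 − p). -/
open Real Set

noncomputable section

/-- On the positive reals, `x ^ s * (a * x - c)` is positive only for `c / a < x`. -/
lemma div_lt_of_rpow_mul_pos {s a c x : ℝ} (ha : 0 < a) (hx : 0 < x)
    (h : 0 < x ^ s * (a * x - c)) : c / a < x := by
  have := (pos_iff_pos_of_mul_pos h).1 (rpow_pos_of_pos hx s)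
  rw [div_lt_iff₀ ha]
  linarith

lemma strictMonoOn_rpow_mul_sub {s a c : ℝ} (hs : 0 < s) (ha : 0 < a) (hc : 0 < c) :
    StrictMonoOn (fun x : ℝ ↦ x ^ s * (a * x - c)) (Ioi (c / a)) := by
  intro x hx y hy hxy
  have hx0 : 0 < x := (div_pos hc ha).trans hx
  have hax : c < a * x := by
    have := (div_lt_iff₀ ha).1 (mem_Ioi.1 hx)
    linarith
  have hpow : x ^ s < y ^ s := rpow_lt_rpow hx0.le hxy hs
  have hlin : a * x - c < a * y - c := by
    have := mul_lt_mul_of_pos_left hxy ha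
    linarith
  exact mul_lt_mul'' hpow hlin (rpow_nonneg hx0.le s) (by linarith)

lemma exists_rpow_mul_sub_eq {s a c r : ℝ} (hs : 0 < s) (ha : 0 < a) (hac : a ≤ c) (hr : 0 < r) :
    ∃ x : ℝ, 1 < x ∧ x ^ s * (a * x - c) = r := by
  have h1 : 1 ≤ c / a := (one_le_div ha).2 hac
  have hb : c / a ≤ (c + r) / a := by gcongr; linarith
  have hcont : ContinuousOn (fun x : ℝ ↦ x ^ s * (a * x - c)) (Icc (c / a) ((c + r) / a)) :=
    ((continuous_id.rpow_const fun _ ↦ Or.inr hs.le).mul (by fun_prop)).continuousOn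
  have hmem : r ∈ Icc ((c / a) ^ s * (a * (c / a) - c))
      (((c + r) / a) ^ s * (a * ((c + r) / a) - c)) := by
    rw [mul_div_cancel₀ _ ha.ne', mul_div_cancel₀ _ ha.ne']
    refine ⟨by simpa using hr.le, ?_⟩
    rw [add_sub_cancel_left]
    exact le_mul_of_one_le_left hr.le (one_le_rpow (h1.trans hb) hs.le)
  obtain ⟨x, hx, hxr⟩ := intermediate_value_Icc hb hcont hmem
  have hx0 : 0 < x := by linarith [hx.1]
  exact ⟨x, h1.trans_lt (div_lt_of_rpow_mul_pos ha hx0 (hr.trans_eq hxr.symm)), hxr⟩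

theorem stmt1 (μ σ δ p α κ : ℝ)
    (hμ : 0 < μ) (hσ : 0 < σ) (hδ : 0 < δ) (hκ : κ = 2 * σ ^ 2 / μ ^ 2)
    (hα : α ∈ Set.Ioo (0 : ℝ) 1) (hp1 : 1 / (1 + κ * δ) < p) (hp2 : p < 1) :
    (∃! η : ℝ, 1 < η ∧
        κ * η ^ (1 + κ * δ) / (1 + κ * δ) - η ^ (κ * δ) / (δ * (1 - p)) =
          (1 - α ^ (p * (1 + κ * δ) - 1)) /
            (δ * (1 + κ * δ) * (p * (1 + κ * δ) - 1))) ∧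
      ∀ η : ℝ,
        (1 < η ∧
          κ * η ^ (1 + κ * δ) / (1 + κ * δ) - η ^ (κ * δ) / (δ * (1 - p)) =
            (1 - α ^ (p * (1 + κ * δ) - 1)) /
              (δ * (1 + κ * δ) * (p * (1 + κ * δ) - 1))) →
          1 / (1 - p) < η := by
  have hκ0 : 0 < κ := by rw [hκ]; positivity
  have hs : 0 < κ * δ := mul_pos hκ0 hδ
  have hs1 : 0 < 1 + κ * δ := by linarith
  have hq : 0 < 1 - p := by linarith
  have hp0 : 0 < p := (one_div_pos.2 hs1).trans hp1
  have he : 0 < p * (1 + κ * δ) - 1 := sub_pos.2 ((div_lt_iff₀ hs1).1 hp1)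
  have hr : 0 < (1 - α ^ (p * (1 + κ * δ) - 1)) /
      (δ * (1 + κ * δ) * (p * (1 + κ * δ) - 1)) :=
    div_pos (sub_pos.2 (rpow_lt_one hα.1.le hα.2 he)) (by positivity)
  have ha : 0 < κ / (1 + κ * δ) := div_pos hκ0 hs1
  have hc : 0 < 1 / (δ * (1 - p)) := by positivity
  have hroot : 1 / (1 - p) < 1 / (δ * (1 - p)) / (κ / (1 + κ * δ)) := by
    have : 1 / (δ * (1 - p)) / (κ / (1 + κ * δ)) = 1 / (1 - p) + 1 / (κ * δ * (1 - p)) := by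
      field_simp
      ring
    rw [this]
    exact lt_add_of_pos_right _ (by positivity)
  have hac : κ / (1 + κ * δ) ≤ 1 / (δ * (1 - p)) := by
    rw [← one_le_div ha]
    exact ((one_le_one_div hq (by linarith)).trans_lt hroot).le
  have hfac : ∀ η : ℝ, 1 < η →
      κ * η ^ (1 + κ * δ) / (1 + κ * δ) - η ^ (κ * δ) / (δ * (1 - p)) =
        η ^ (κ * δ) * (κ / (1 + κ * δ) * η - 1 / (δ * (1 - p))) := by
    intro η hη
    rw [rpow_add (by linarith), rpow_one]
    ring
  generalize (1 - α ^ (p * (1 + κ * δ) - 1)) /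
    (δ * (1 + κ * δ) * (p * (1 + κ * δ) - 1)) = r at hr ⊢
  have hgt : ∀ η : ℝ, 1 < η →
      η ^ (κ * δ) * (κ / (1 + κ * δ) * η - 1 / (δ * (1 - p))) = r →
        1 / (δ * (1 - p)) / (κ / (1 + κ * δ)) < η := fun η hη h ↦
    div_lt_of_rpow_mul_pos ha (by linarith) (hr.trans_eq h.symm)
  refine ⟨?_, fun η ⟨hη, h⟩ ↦ hroot.trans (hgt η hη (hfac η hη ▸ h))⟩
  obtain ⟨η, hη, h⟩ := exists_rpow_mul_sub_eq hs ha hac hr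
  refine ⟨η, ⟨hη, (hfac η hη).trans h⟩, fun ζ ⟨hζ, hζr⟩ ↦ ?_⟩
  rw [hfac ζ hζ] at hζr
  exact (strictMonoOn_rpow_mul_sub hs ha hc).injOn (hgt ζ hζ hζr) (hgt η hη h) (hζr.trans h.symm)

end
end

section
/- The function Û is continuously differentiable on [y*, y₀] and twice continuously differentiable on (y*, y₀); it satisfies the linear ordinary differential equation y²·Û″(y) + κδ·y·Û′(y) − κδ·Û(y) = κ·(α·y − α^{1−p}/(1−p)) for α^{−p} ≤ y ≤ y₀, y²·Û″(y) + κδ·y·Û′(y) − κδ·Û(y) = −(κp/(1−p))·y^{−(1−p)/p} for 1 < y < α^{−p}, and y²·Û″(y) + κδ·y·Û′(y) − κδ·Û(y) = κ·(y − 1/(1−p)) for y* ≤ y ≤ 1; and it satisfies the boundary conditions Û(y₀) = 0, Û′(y₀) = 0, (1−p)·Û(y*) + p·y*·Û′(y*) = 0, and Û′(y*) + p·y*·Û″(y*) = 0. -/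
open Real Set

noncomputable section

theorem hasDerivAt_ite_le {E : Type*} [NormedAddCommGroup E] [NormedSpace ℝ E]
    {f g f' g' : ℝ → E} {c y : ℝ}
    (hf : c ≤ y → HasDerivAt f (f' y) y) (hg : y ≤ c → HasDerivAt g (g' y) y)
    (h : f c = g c) (h' : f' c = g' c) :
    HasDerivAt (fun x => if c ≤ x then f x else g x) (if c ≤ y then f' y else g' y) y := by
  rcases lt_trichotomy y c with hlt | rfl | hgt
  · rw [if_neg hlt.not_ge]
    refine (hg hlt.le).congr_of_eventuallyEq ?_
    filter_upwards [Iio_mem_nhds hlt] with x hx using if_neg (not_le.2 hx)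
  · rw [if_pos le_rfl]
    have hr : HasDerivWithinAt (fun x => if y ≤ x then f x else g x) (f' y) (Ici y) y :=
      (hf le_rfl).hasDerivWithinAt.congr (fun x hx => if_pos hx) (if_pos le_rfl)
    have hl : HasDerivWithinAt (fun x => if y ≤ x then f x else g x) (f' y) (Iic y) y := by
      rw [h']
      refine (hg le_rfl).hasDerivWithinAt.congr (fun x hx => ?_) (by simp [h])
      rcases (show x ≤ y from hx).eq_or_lt with rfl | hlt
      · simp [h]
      · exact if_neg hlt.not_ge
    have := hl.union hr
    rwa [Iic_union_Ici, hasDerivWithinAt_univ] at this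
  · rw [if_pos hgt.le]
    refine (hf hgt.le).congr_of_eventuallyEq ?_
    filter_upwards [Ioi_mem_nhds hgt] with x hx using if_pos (le_of_lt hx)

theorem ContinuousOn.ite_le {E : Type*} [TopologicalSpace E] {f g : ℝ → E} {s : Set ℝ} {c : ℝ}
    (hf : ContinuousOn f s) (hg : ContinuousOn g s) (h : f c = g c) :
    ContinuousOn (fun x => if c ≤ x then f x else g x) s := by
  refine ContinuousOn.if ?_ (hf.mono inter_subset_left) (hg.mono inter_subset_left)
  rintro a ⟨-, ha⟩
  have : a = c := by
    change a ∈ frontier (Ici c) at ha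
    simpa using ha
  rw [this, h]

/-- The general shape `a y + b y^(-s) + c y log y + d y^q + e` of the pieces of `Uhat`. -/
def piece (a b c d e s q y : ℝ) : ℝ :=
  a * y + b * y ^ (-s) + c * (y * Real.log y) + d * y ^ q + e

/-- The derivative of `piece`. -/
def pieceDeriv (a b c d s q y : ℝ) : ℝ :=
  a - b * s * (y ^ (-s) / y) + c * (Real.log y + 1) + d * q * (y ^ q / y)

/-- The second derivative of `piece`. -/
def pieceDeriv₂ (b c d s q y : ℝ) : ℝ :=
  b * s * (s + 1) * (y ^ (-s) / y ^ 2) + c / y + d * q * (q - 1) * (y ^ q / y ^ 2)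

theorem hasDerivAt_rpow_const_div {y : ℝ} (q : ℝ) (hy : 0 < y) :
    HasDerivAt (fun x : ℝ => x ^ q) (q * (y ^ q / y)) y := by
  rw [← Real.rpow_sub_one hy.ne']
  exact Real.hasDerivAt_rpow_const (Or.inl hy.ne')

theorem hasDerivAt_piece (a b c d e s q : ℝ) {y : ℝ} (hy : 0 < y) :
    HasDerivAt (piece a b c d e s q) (pieceDeriv a b c d s q y) y := by
  have h := (((((hasDerivAt_id y).const_mul a).add
    ((hasDerivAt_rpow_const_div (-s) hy).const_mul b)).add
    (((hasDerivAt_id y).mul (Real.hasDerivAt_log hy.ne')).const_mul c)).add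
    ((hasDerivAt_rpow_const_div q hy).const_mul d)).add_const e
  refine h.congr_deriv ?_
  simp only [pieceDeriv, id]
  field_simp
  ring

theorem hasDerivAt_pieceDeriv (a b c d s q : ℝ) {y : ℝ} (hy : 0 < y) :
    HasDerivAt (pieceDeriv a b c d s q) (pieceDeriv₂ b c d s q y) y := by
  have h := ((((hasDerivAt_rpow_const_div (-s) hy).div (hasDerivAt_id y) hy.ne').const_mul
    (b * s)).const_sub a |>.add (((Real.hasDerivAt_log hy.ne').add_const 1).const_mul c)).add
    (((hasDerivAt_rpow_const_div q hy).div (hasDerivAt_id y) hy.ne').const_mul (d * q))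
  refine h.congr_deriv ?_
  simp only [pieceDeriv₂, id]
  field_simp
  ring

theorem continuousOn_pieceDeriv₂ (b c d s q : ℝ) :
    ContinuousOn (pieceDeriv₂ b c d s q) (Ioi 0) := by
  intro y hy
  have hy' : y ≠ 0 := (show (0 : ℝ) < y from hy).ne'
  have h (r : ℝ) : ContinuousAt (fun x : ℝ => x ^ r) y :=
    Real.continuousAt_rpow_const y r (Or.inl hy')
  have h₂ : ContinuousAt (fun x : ℝ => x ^ 2) y := by fun_prop
  exact (((((h (-s)).div h₂ (pow_ne_zero 2 hy')).const_mul _).add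
    (continuousAt_const.div continuousAt_id hy')).add
    (((h q).div h₂ (pow_ne_zero 2 hy')).const_mul _)).continuousWithinAt

/-- The Euler operator `y² u'' + s y u' - s u` annihilates `y` and `y^(-s)`. -/
theorem euler_piece (a b c d e s q : ℝ) {y : ℝ} (hy : 0 < y) :
    y ^ 2 * pieceDeriv₂ b c d s q y + s * y * pieceDeriv a b c d s q y -
        s * piece a b c d e s q y =
      c * (1 + s) * y + d * ((q - 1) * (q + s)) * y ^ q - s * e := by
  simp only [piece, pieceDeriv, pieceDeriv₂]
  field_simp
  ring

/-- The function equal to `h` below `1`, to `g` on `[1, u)` and to `f` from `u` on. -/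
def patch (u : ℝ) (f g h : ℝ → ℝ) (y : ℝ) : ℝ :=
  if u ≤ y then f y else if 1 ≤ y then g y else h y

theorem hasDerivAt_patch {u : ℝ} (hu : 1 < u) {f g h f' g' h' : ℝ → ℝ}
    (hf : ∀ y, 0 < y → HasDerivAt f (f' y) y) (hg : ∀ y, 0 < y → HasDerivAt g (g' y) y)
    (hh : ∀ y, 0 < y → HasDerivAt h (h' y) y) (hu₀ : f u = g u) (hu₁ : f' u = g' u)
    (h₀ : g 1 = h 1) (h₁ : g' 1 = h' 1) {y : ℝ} (hy : 0 < y) :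
    HasDerivAt (patch u f g h) (patch u f' g' h' y) y := by
  refine hasDerivAt_ite_le (g' := fun y => if 1 ≤ y then g' y else h' y) (fun _ => hf y hy)
    (fun _ => hasDerivAt_ite_le (fun _ => hg y hy) (fun _ => hh y hy) h₀ h₁) ?_ ?_ <;>
  simpa [hu.le]

theorem continuousOn_patch {u : ℝ} (hu : 1 < u) {f g h : ℝ → ℝ} {s : Set ℝ}
    (hf : ContinuousOn f s) (hg : ContinuousOn g s) (hh : ContinuousOn h s)
    (hu₀ : f u = g u) (h₀ : g 1 = h 1) : ContinuousOn (patch u f g h) s :=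
  hf.ite_le (hg.ite_le hh h₀) (by simpa [hu.le])

theorem patch_of_le {u y : ℝ} {f g h : ℝ → ℝ} (hy : u ≤ y) : patch u f g h y = f y :=
  if_pos hy

theorem patch_of_mem_Ioo {u y : ℝ} {f g h : ℝ → ℝ} (hy : 1 < y) (hyu : y < u) :
    patch u f g h y = g y := by
  simp [patch, hyu.not_ge, hy.le]

theorem patch_of_le_one {u y : ℝ} {f g h : ℝ → ℝ} (hu : 1 < u) (h₀ : g 1 = h 1) (hy : y ≤ 1) :
    patch u f g h y = h y := by
  rcases hy.eq_or_lt with rfl | hlt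
  · simp [patch, hu.not_ge, h₀]
  · simp [patch, (hlt.trans hu).not_ge, hlt.not_ge]

theorem contDiffOn_two_of_hasDerivAt {f f' f'' : ℝ → ℝ} {s : Set ℝ} (hs : IsOpen s)
    (hf : ∀ y ∈ s, HasDerivAt f (f' y) y) (hf' : ∀ y ∈ s, HasDerivAt f' (f'' y) y)
    (hc : ContinuousOn f'' s) : ContDiffOn ℝ 2 f s := by
  have h₁ : ContDiffOn ℝ 1 f' s := by
    rw [show (1 : WithTop ℕ∞) = 0 + 1 from rfl, contDiffOn_succ_iff_deriv_of_isOpen hs]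
    exact ⟨fun y hy => (hf' y hy).differentiableAt.differentiableWithinAt, by simp,
      contDiffOn_zero.2 (hc.congr fun y hy => (hf' y hy).deriv)⟩
  rw [show (2 : WithTop ℕ∞) = 1 + 1 from rfl, contDiffOn_succ_iff_deriv_of_isOpen hs]
  exact ⟨fun y hy => (hf y hy).differentiableAt.differentiableWithinAt, by simp,
    h₁.congr fun y hy => (hf y hy).deriv⟩

theorem stmt2 (μ σ δ p α κ : ℝ)
    (hμ : 0 < μ) (hσ : 0 < σ) (hδ : 0 < δ) (hκ : κ = 2 * σ ^ 2 / μ ^ 2)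
    (hα : α ∈ Set.Ioo (0 : ℝ) 1) (hp1 : 1 / (1 + κ * δ) < p) (hp2 : p < 1) (ystar ηstar y0 : ℝ)
    (hy : ystar ∈ Set.Ioo (0 : ℝ) 1) (hη : 1 < ηstar)
    (hS : SystemS κ δ p α ystar ηstar) (hy0 : y0 = ηstar * α ^ (-p)) :
    ContDiffOn ℝ 1 (Uhat κ δ p α ηstar) (Set.Icc ystar y0) ∧
    ContDiffOn ℝ 2 (Uhat κ δ p α ηstar) (Set.Ioo ystar y0) ∧
    (∀ y : ℝ, α ^ (-p) ≤ y → y ≤ y0 →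
      y ^ 2 * deriv (deriv (Uhat κ δ p α ηstar)) y +
          κ * δ * y * deriv (Uhat κ δ p α ηstar) y -
          κ * δ * Uhat κ δ p α ηstar y =
        κ * (α * y - α ^ (1 - p) / (1 - p))) ∧
    (∀ y : ℝ, 1 < y → y < α ^ (-p) →
      y ^ 2 * deriv (deriv (Uhat κ δ p α ηstar)) y +
          κ * δ * y * deriv (Uhat κ δ p α ηstar) y -
          κ * δ * Uhat κ δ p α ηstar y =
        -(κ * p / (1 - p)) * y ^ (-(1 - p) / p)) ∧
    (∀ y : ℝ, ystar ≤ y → y ≤ 1 →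
      y ^ 2 * deriv (deriv (Uhat κ δ p α ηstar)) y +
          κ * δ * y * deriv (Uhat κ δ p α ηstar) y -
          κ * δ * Uhat κ δ p α ηstar y =
        κ * (y - 1 / (1 - p))) ∧
    Uhat κ δ p α ηstar y0 = 0 ∧
    deriv (Uhat κ δ p α ηstar) y0 = 0 ∧
    (1 - p) * Uhat κ δ p α ηstar ystar +
        p * ystar * deriv (Uhat κ δ p α ηstar) ystar = 0 ∧
    deriv (Uhat κ δ p α ηstar) ystar +
        p * ystar * deriv (deriv (Uhat κ δ p α ηstar)) ystar = 0 := by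
  obtain ⟨hα0, hα1⟩ := hα
  obtain ⟨hys0, hys1⟩ := hy
  have hκ0 : 0 < κ := by rw [hκ]; positivity
  have hp0 : 0 < p := lt_trans (by positivity) hp1
  have hr : p * (1 + κ * δ) - 1 ≠ 0 := by
    rw [div_lt_iff₀ (by positivity)] at hp1
    linarith
  have hp' : 1 - p ≠ 0 := by linarith
  have hb : 1 + κ * δ ≠ 0 := by positivity
  have hu1 : 1 < α ^ (-p) := Real.one_lt_rpow_of_pos_of_lt_one_of_neg hα0 hα1 (by linarith)
  have hη0 : 0 < ηstar := by linarith
  have hu0 : 0 < α ^ (-p) := by linarith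
  have hv0 : 0 < (α ^ (-p)) ^ (-(κ * δ)) := by positivity
  have hw0 : 0 < ηstar ^ (κ * δ) := by positivity
  have hz0 : 0 < ystar ^ (κ * δ) := by positivity
  have hlogu : Real.log (α ^ (-p)) = -(p * Real.log α) := by
    rw [Real.log_rpow hα0]; ring
  have hA : α ^ (1 - p * (1 + κ * δ)) = α * α ^ (-p) / (α ^ (-p)) ^ (-(κ * δ)) := by
    rw [← Real.rpow_mul hα0.le, ← Real.rpow_one_add' hα0.le (by linarith),
      ← Real.rpow_sub hα0]
    ring_nf
  have hαp : α ^ (1 - p) = α * α ^ (-p) := by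
    rw [← Real.rpow_one_add' hα0.le (by linarith)]
    ring_nf
  have huq : (α ^ (-p)) ^ (-(1 - p) / p) = α * α ^ (-p) := by
    rw [← hαp, ← Real.rpow_mul hα0.le]
    congr 1
    field_simp
  have hηw : ηstar ^ (1 + κ * δ) = ηstar * ηstar ^ (κ * δ) :=
    Real.rpow_one_add' hη0.le hb
  have hyz : ystar ^ (1 + κ * δ) = ystar * ystar ^ (κ * δ) :=
    Real.rpow_one_add' hys0.le hb
  have hyz' : ystar ^ (-(κ * δ)) = 1 / ystar ^ (κ * δ) := by
    rw [Real.rpow_neg hys0.le, one_div]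
  have hy0s : y0 ^ (-(κ * δ)) = (α ^ (-p)) ^ (-(κ * δ)) / ηstar ^ (κ * δ) := by
    rw [hy0, Real.mul_rpow hη0.le hu0.le, Real.rpow_neg hη0.le]
    field_simp
  have hlogy0 : Real.log y0 = Real.log ηstar - p * Real.log α := by
    rw [hy0, Real.log_mul hη0.ne' hu0.ne', hlogu]; ring
  have hy0u : α ^ (-p) ≤ y0 := by rw [hy0]; nlinarith
  obtain ⟨hE1, hE2⟩ := hS
  set c₁ := C1 κ δ p α ηstar with hc₁
  set c₂ := C2 κ δ p α ηstar with hc₂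
  set c₃ := C3 κ δ p α ηstar with hc₃
  set c₄ := C4 κ δ p α ηstar with hc₄
  set c₅ := C5 κ δ p α ηstar with hc₅
  set c₆ := C6 κ δ p α ηstar with hc₆
  set k := κ * p ^ 3 / ((1 - p) * (p * (1 + κ * δ) - 1)) with hk
  set q := -(1 - p) / p with hq
  set f := piece c₁ c₂ (κ * α / (1 + κ * δ)) 0 (α ^ (1 - p) / (δ * (1 - p))) (κ * δ) q with hf
  set g := piece c₃ c₄ 0 k 0 (κ * δ) q with hg
  set h := piece c₅ c₆ (κ / (1 + κ * δ)) 0 (1 / (δ * (1 - p))) (κ * δ) q with hh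
  set f' := pieceDeriv c₁ c₂ (κ * α / (1 + κ * δ)) 0 (κ * δ) q with hf'
  set g' := pieceDeriv c₃ c₄ 0 k (κ * δ) q with hg'
  set h' := pieceDeriv c₅ c₆ (κ / (1 + κ * δ)) 0 (κ * δ) q with hh'
  set f'' := pieceDeriv₂ c₂ (κ * α / (1 + κ * δ)) 0 (κ * δ) q with hf''
  set g'' := pieceDeriv₂ c₄ 0 k (κ * δ) q with hg''
  set h'' := pieceDeriv₂ c₆ (κ / (1 + κ * δ)) 0 (κ * δ) q with hh''
  have hfu : f (α ^ (-p)) = g (α ^ (-p)) := by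
    simp only [hf, hg, piece, hlogu, huq, hαp, hc₁, hc₂, hc₃, hc₄, C1, C2, C3, C4, hA, hηw, hk]
    generalize (α ^ (-p)) ^ (-(κ * δ)) = v at *
    generalize α ^ (-p) = u at *
    generalize hrr : p * (1 + κ * δ) - 1 = r at hr ⊢
    field_simp
    subst hrr
    ring
  have hfu' : f' (α ^ (-p)) = g' (α ^ (-p)) := by
    simp only [hf', hg', pieceDeriv, hlogu, huq, hc₁, hc₂, hc₃, hc₄, C1, C2, C3, C4, hA, hηw,
      hk]
    generalize (α ^ (-p)) ^ (-(κ * δ)) = v at *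
    generalize α ^ (-p) = u at *
    rw [hq]
    generalize hrr : p * (1 + κ * δ) - 1 = r at hr ⊢
    field_simp
    subst hrr
    ring
  have hg1 : g 1 = h 1 := by
    simp only [hg, hh, piece, Real.one_rpow, Real.log_one, hc₃, hc₄, hc₅, hc₆, C2, C3, C4, C5,
      C6, hk]
    generalize hrr : p * (1 + κ * δ) - 1 = r at hr ⊢
    field_simp
    subst hrr
    ring
  have hg1' : g' 1 = h' 1 := by
    simp only [hg', hh', pieceDeriv, Real.one_rpow, Real.log_one, hc₃, hc₄, hc₅, hc₆, C2, C3,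
      C4, C5, C6, hk, hq]
    generalize hrr : p * (1 + κ * δ) - 1 = r at hr ⊢
    field_simp
    subst hrr
    ring
  have hqe : k * ((q - 1) * (q + κ * δ)) = -(κ * p / (1 - p)) := by
    rw [hk, hq]
    generalize hrr : p * (1 + κ * δ) - 1 = r at hr ⊢
    field_simp
    subst hrr
    ring
  have hof (y : ℝ) (hy : 0 < y) : y ^ 2 * f'' y + κ * δ * y * f' y - κ * δ * f y =
      κ * (α * y - α ^ (1 - p) / (1 - p)) := by
    rw [hf, hf', hf'', euler_piece _ _ _ _ _ _ _ hy]
    field_simp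
    ring
  have hog (y : ℝ) (hy : 0 < y) : y ^ 2 * g'' y + κ * δ * y * g' y - κ * δ * g y =
      -(κ * p / (1 - p)) * y ^ q := by
    rw [hg, hg', hg'', euler_piece _ _ _ _ _ _ _ hy, hqe]
    ring
  have hoh (y : ℝ) (hy : 0 < y) : y ^ 2 * h'' y + κ * δ * y * h' y - κ * δ * h y =
      κ * (y - 1 / (1 - p)) := by
    rw [hh, hh', hh'', euler_piece _ _ _ _ _ _ _ hy]
    field_simp
    ring
  have hfu'' : f'' (α ^ (-p)) = g'' (α ^ (-p)) := by
    have h₁ := hof _ hu0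
    have h₂ := hog _ hu0
    rw [← hfu, ← hfu', huq] at h₂
    have h₃ : κ * (α * α ^ (-p) - α ^ (1 - p) / (1 - p)) =
        -(κ * p / (1 - p)) * (α * α ^ (-p)) := by
      rw [hαp]
      field_simp
      ring
    exact mul_left_cancel₀ (pow_ne_zero 2 hu0.ne') (by linarith)
  have hg1'' : g'' 1 = h'' 1 := by
    have h₁ := hog 1 one_pos
    have h₂ := hoh 1 one_pos
    rw [← hg1, ← hg1'] at h₂
    rw [Real.one_rpow] at h₁
    have h₃ : -(κ * p / (1 - p)) * 1 = κ * (1 - 1 / (1 - p)) := by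
      field_simp
      ring
    linarith
  have hU : Uhat κ δ p α ηstar = patch (α ^ (-p)) f g h := by
    funext y
    by_cases hyu : α ^ (-p) ≤ y
    · rw [patch_of_le hyu, Uhat, if_pos hyu, hf, piece]
      ring
    by_cases hy1 : 1 < y
    · rw [patch_of_mem_Ioo hy1 (not_le.1 hyu), Uhat, if_neg hyu, if_pos hy1, hg, piece]
      ring
    · rw [patch_of_le_one hu1 hg1 (not_lt.1 hy1), Uhat, if_neg hyu, if_neg hy1, hh, piece]
      ring
  have hd (y : ℝ) (hy : 0 < y) :
      HasDerivAt (Uhat κ δ p α ηstar) (patch (α ^ (-p)) f' g' h' y) y := by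
    rw [hU]
    exact hasDerivAt_patch hu1 (fun _ => hasDerivAt_piece _ _ _ _ _ _ _)
      (fun _ => hasDerivAt_piece _ _ _ _ _ _ _) (fun _ => hasDerivAt_piece _ _ _ _ _ _ _)
      hfu hfu' hg1 hg1' hy
  have hd' (y : ℝ) (hy : 0 < y) :
      HasDerivAt (patch (α ^ (-p)) f' g' h') (patch (α ^ (-p)) f'' g'' h'' y) y :=
    hasDerivAt_patch hu1 (fun _ => hasDerivAt_pieceDeriv _ _ _ _ _ _)
      (fun _ => hasDerivAt_pieceDeriv _ _ _ _ _ _) (fun _ => hasDerivAt_pieceDeriv _ _ _ _ _ _)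
      hfu' hfu'' hg1' hg1'' hy
  have hU₁ (y : ℝ) (hy : 0 < y) :
      deriv (Uhat κ δ p α ηstar) y = patch (α ^ (-p)) f' g' h' y := (hd y hy).deriv
  have hU₂ (y : ℝ) (hy : 0 < y) :
      deriv (deriv (Uhat κ δ p α ηstar)) y = patch (α ^ (-p)) f'' g'' h'' y := by
    refine ((hd' y hy).congr_of_eventuallyEq ?_).deriv
    filter_upwards [Ioi_mem_nhds hy] with x hx using hU₁ x hx
  have hC : ContDiffOn ℝ 2 (Uhat κ δ p α ηstar) (Ioi 0) :=
    contDiffOn_two_of_hasDerivAt isOpen_Ioi hd hd' (continuousOn_patch hu1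
      (continuousOn_pieceDeriv₂ _ _ _ _ _) (continuousOn_pieceDeriv₂ _ _ _ _ _)
      (continuousOn_pieceDeriv₂ _ _ _ _ _) hfu'' hg1'')
  have hy00 : 0 < y0 := hu0.trans_le hy0u
  refine ⟨(hC.of_le one_le_two).mono fun y hy => hys0.trans_le hy.1,
    hC.mono fun y hy => hys0.trans hy.1, ?_, ?_, ?_, ?_, ?_, ?_, ?_⟩
  · intro y hy _
    have hy' := hu0.trans_le hy
    rw [hU₂ y hy', hU₁ y hy', hU, patch_of_le hy, patch_of_le hy, patch_of_le hy]
    exact hof y hy'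
  · intro y hy hyu
    have hy' := one_pos.trans hy
    rw [hU₂ y hy', hU₁ y hy', hU, patch_of_mem_Ioo hy hyu, patch_of_mem_Ioo hy hyu,
      patch_of_mem_Ioo hy hyu]
    exact hog y hy'
  · intro y hy hy1
    have hy' := hys0.trans_le hy
    rw [hU₂ y hy', hU₁ y hy', hU, patch_of_le_one hu1 hg1 hy1, patch_of_le_one hu1 hg1' hy1,
      patch_of_le_one hu1 hg1'' hy1]
    exact hoh y hy'
  · rw [hU, patch_of_le hy0u]
    simp only [hf, piece, hlogy0, hy0s, hαp, hc₁, hc₂, C1, C2, hA, hηw]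
    rw [hy0]
    generalize (α ^ (-p)) ^ (-(κ * δ)) = v at *
    generalize α ^ (-p) = u at *
    field_simp
    ring
  · rw [hU₁ y0 hy00, patch_of_le hy0u]
    simp only [hf', pieceDeriv, hlogy0, hy0s, hc₁, hc₂, C1, C2, hA, hηw]
    rw [hy0]
    generalize (α ^ (-p)) ^ (-(κ * δ)) = v at *
    generalize α ^ (-p) = u at *
    field_simp
    ring
  · rw [hU₁ ystar hys0, hU, patch_of_le_one hu1 hg1 hys1.le, patch_of_le_one hu1 hg1' hys1.le]
    have hlin : (1 - p) * h ystar + p * ystar * h' ystar =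
        -(κ / (1 + κ * δ) * ystar) * (α * Real.log ηstar - Real.log ystar +
          α / (ηstar * (1 - p)) - 1 / ystar - (α * (1 + p) - 1)) -
        1 / (ystar ^ (κ * δ) * (1 + κ * δ)) *
          (α ^ (1 - p * (1 + κ * δ)) * (p * (1 + κ * δ) - 1) *
            (κ * ηstar ^ (1 + κ * δ) / (1 + κ * δ) - ηstar ^ (κ * δ) / (δ * (1 - p))) +
            (κ * ystar ^ (1 + κ * δ) / (1 + κ * δ) - ystar ^ (κ * δ) / δ) -
            (α ^ (1 - p * (1 + κ * δ)) - 1) / (δ * (1 + κ * δ))) := by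
      simp only [hh, hh', piece, pieceDeriv, hyz', hyz, hc₅, hc₆, C2, C5, C6]
      generalize hrr : p * (1 + κ * δ) - 1 = r at hr ⊢
      field_simp
      subst hrr
      ring
    rw [hlin, hE1, hE2]
    ring
  · rw [hU₁ ystar hys0, hU₂ ystar hys0, patch_of_le_one hu1 hg1' hys1.le,
      patch_of_le_one hu1 hg1'' hys1.le]
    have hlin : h' ystar + p * ystar * h'' ystar =
        -(κ / (1 + κ * δ)) * (α * Real.log ηstar - Real.log ystar +
          α / (ηstar * (1 - p)) - 1 / ystar - (α * (1 + p) - 1)) +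
        κ * δ / (ystar * ystar ^ (κ * δ) * (1 + κ * δ)) *
          (α ^ (1 - p * (1 + κ * δ)) * (p * (1 + κ * δ) - 1) *
            (κ * ηstar ^ (1 + κ * δ) / (1 + κ * δ) - ηstar ^ (κ * δ) / (δ * (1 - p))) +
            (κ * ystar ^ (1 + κ * δ) / (1 + κ * δ) - ystar ^ (κ * δ) / δ) -
            (α ^ (1 - p * (1 + κ * δ)) - 1) / (δ * (1 + κ * δ))) := by
      simp only [hh', hh'', pieceDeriv, pieceDeriv₂, hyz', hyz, hc₅, hc₆, C2, C5, C6]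
      generalize hrr : p * (1 + κ * δ) - 1 = r at hr ⊢
      field_simp
      subst hrr
      ring
    rw [hlin, hE1, hE2]
    ring

end
end

section
/- The constants satisfy the identities C₃ = −(κ/(1+κδ))·(ln y* + 1/y* − 1), C₄ = (1/(δ(1+κδ)(p(1+κδ)−1)))·( −1/(1+κδ) + (y*)^{κδ} − (κδ/(1+κδ))·(y*)^{1+κδ} ), C₅ = −(κ/(1+κδ))·(ln y* + 1/y* + p + 1/(1+κδ)), and C₆ = (1/(δ(1+κδ)(p(1+κδ)−1)))·( (y*)^{κδ} − (κδ/(1+κδ))·(y*)^{1+κδ} ); moreover C₂ > 0, C₄ < 0, and C₆ > 0. -/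
open Real Set

noncomputable section

/-- Bernoulli's inequality for `y⁻¹`, with denominators cleared. -/
lemma one_add_mul_rpow_sub_mul_rpow_one_add_lt_one {a y : ℝ} (ha : 0 < a) (hy0 : 0 < y)
    (hy1 : y < 1) : (1 + a) * y ^ a - a * y ^ (1 + a) < 1 := by
  have ht : 1 < y⁻¹ := (one_lt_inv₀ hy0).2 hy1
  have hB := one_add_mul_self_lt_rpow_one_add (s := y⁻¹ - 1) (p := 1 + a)
    (by linarith) (by linarith) (by linarith)
  rw [add_sub_cancel, Real.inv_rpow hy0.le] at hB
  have hpow : 0 < y ^ (1 + a) := Real.rpow_pos_of_pos hy0 _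
  have hmul := mul_lt_mul_of_pos_right hB hpow
  rw [inv_mul_cancel₀ hpow.ne'] at hmul
  have hsplit : y ^ (1 + a) = y * y ^ a := by rw [Real.rpow_add hy0, Real.rpow_one]
  have hcancel : y⁻¹ * y ^ (1 + a) = y ^ a := by
    rw [hsplit, inv_mul_cancel_left₀ hy0.ne']
  linear_combination hmul - (1 + a) * hcancel

theorem stmt4 (μ σ δ p α κ : ℝ)
    (hμ : 0 < μ) (hσ : 0 < σ) (hδ : 0 < δ) (hκ : κ = 2 * σ ^ 2 / μ ^ 2)
    (hα : α ∈ Set.Ioo (0 : ℝ) 1) (hp1 : 1 / (1 + κ * δ) < p) (hp2 : p < 1) (ystar ηstar : ℝ)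
    (hy : ystar ∈ Set.Ioo (0 : ℝ) 1) (hη : 1 < ηstar)
    (hS : SystemS κ δ p α ystar ηstar) :
    C3 κ δ p α ηstar =
        -(κ / (1 + κ * δ)) * (Real.log ystar + 1 / ystar - 1) ∧
    C4 κ δ p α ηstar =
        1 / (δ * (1 + κ * δ) * (p * (1 + κ * δ) - 1)) *
          (-(1 / (1 + κ * δ)) + ystar ^ (κ * δ) -
            κ * δ / (1 + κ * δ) * ystar ^ (1 + κ * δ)) ∧
    C5 κ δ p α ηstar =
        -(κ / (1 + κ * δ)) *
          (Real.log ystar + 1 / ystar + p + 1 / (1 + κ * δ)) ∧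
    C6 κ δ p α ηstar =
        1 / (δ * (1 + κ * δ) * (p * (1 + κ * δ) - 1)) *
          (ystar ^ (κ * δ) - κ * δ / (1 + κ * δ) * ystar ^ (1 + κ * δ)) ∧
    0 < C2 κ δ p α ηstar ∧ C4 κ δ p α ηstar < 0 ∧ 0 < C6 κ δ p α ηstar := by
  have hκ0 : 0 < κ := by rw [hκ]; positivity
  obtain ⟨hα0, hα1⟩ := hα
  obtain ⟨hy0, hy1⟩ := hy
  obtain ⟨hE1, hE2⟩ := hS
  have ha : 0 < κ * δ := mul_pos hκ0 hδ
  have hq : 0 < 1 + κ * δ := by linarith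
  have hm : 0 < p * (1 + κ * δ) - 1 := by
    rw [div_lt_iff₀ hq] at hp1
    linarith
  have hA : 1 < α ^ (1 - p * (1 + κ * δ)) :=
    Real.one_lt_rpow_of_pos_of_lt_one_of_neg hα0 hα1 (by linarith)
  have hlog : α * (Real.log ηstar + 1 / (ηstar * (1 - p)) - (1 + p)) =
      Real.log ystar + 1 / ystar - 1 := by
    linear_combination hE1
  have hBern := one_add_mul_rpow_sub_mul_rpow_one_add_lt_one ha hy0 hy1
  have hYpos : 0 < ystar ^ (κ * δ) - κ * δ / (1 + κ * δ) * ystar ^ (1 + κ * δ) := by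
    have hya : 0 < ystar ^ (κ * δ) := Real.rpow_pos_of_pos hy0 _
    have hfrac : κ * δ / (1 + κ * δ) < 1 := (div_lt_one hq).2 (by linarith)
    have hle : ystar ^ (1 + κ * δ) ≤ ystar ^ (κ * δ) :=
      Real.rpow_le_rpow_of_exponent_ge hy0 hy1.le (by linarith)
    have hfrac0 : 0 < κ * δ / (1 + κ * δ) := div_pos ha hq
    nlinarith
  have hYlt : -(1 / (1 + κ * δ)) + ystar ^ (κ * δ) -
      κ * δ / (1 + κ * δ) * ystar ^ (1 + κ * δ) < 0 := by
    have heq : -(1 / (1 + κ * δ)) + ystar ^ (κ * δ) -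
        κ * δ / (1 + κ * δ) * ystar ^ (1 + κ * δ) =
        ((1 + κ * δ) * ystar ^ (κ * δ) - κ * δ * ystar ^ (1 + κ * δ) - 1) / (1 + κ * δ) := by
      field_simp
      ring
    rw [heq]
    exact div_neg_of_neg_of_pos (by linarith) hq
  have hcoef : 0 < 1 / (δ * (1 + κ * δ) * (p * (1 + κ * δ) - 1)) := by positivity
  have hC6 : C6 κ δ p α ηstar =
      1 / (δ * (1 + κ * δ) * (p * (1 + κ * δ) - 1)) *
        (ystar ^ (κ * δ) - κ * δ / (1 + κ * δ) * ystar ^ (1 + κ * δ)) := by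
    simp only [C6, C2]
    generalize κ * ηstar ^ (1 + κ * δ) / (1 + κ * δ) - ηstar ^ (κ * δ) / (δ * (1 - p)) = X at *
    generalize α ^ (1 - p * (1 + κ * δ)) = A at *
    generalize ystar ^ (1 + κ * δ) = y₁ at *
    generalize ystar ^ (κ * δ) = y₀ at *
    generalize hmdef : p * (1 + κ * δ) - 1 = m at *
    field_simp at hE2 ⊢
    linear_combination hE2
  have hC4 : C4 κ δ p α ηstar =
      1 / (δ * (1 + κ * δ) * (p * (1 + κ * δ) - 1)) *
        (-(1 / (1 + κ * δ)) + ystar ^ (κ * δ) -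
          κ * δ / (1 + κ * δ) * ystar ^ (1 + κ * δ)) := by
    have hC4C6 : C4 κ δ p α ηstar = C6 κ δ p α ηstar -
        1 / (δ * (1 + κ * δ) * (p * (1 + κ * δ) - 1)) * (1 / (1 + κ * δ)) := by
      simp only [C4, C6, C2]
      generalize hmdef : p * (1 + κ * δ) - 1 = m at *
      generalize κ * ηstar ^ (1 + κ * δ) / (1 + κ * δ) - ηstar ^ (κ * δ) / (δ * (1 - p)) = X
      field_simp
      ring
    rw [hC4C6, hC6]
    ring
  have hC6pos : 0 < C6 κ δ p α ηstar := hC6 ▸ mul_pos hcoef hYpos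
  refine ⟨?_, hC4, ?_, hC6, ?_, hC4 ▸ mul_neg_of_pos_of_neg hcoef hYlt, hC6pos⟩
  · rw [C3, ← hlog]
    ring
  · rw [C5]
    linear_combination -(κ / (1 + κ * δ)) * hlog
  · have hshift : 0 < (α ^ (1 - p * (1 + κ * δ)) - 1) /
        (δ * (1 + κ * δ) ^ 2 * (p * (1 + κ * δ) - 1)) :=
      div_pos (by linarith) (by positivity)
    rw [C6] at hC6pos
    linarith

end
end

section
/- Let 0 < α₁ < α₂ < 1, and for i = 1, 2 let Û_{αᵢ} denote the function Û constructed with drawdown parameter αᵢ, with corresponding endpoints y*(αᵢ) and y₀(αᵢ). Then for every y in the intersection (y*(α₁), y₀(α₁)) ∩ (y*(α₂), y₀(α₂)), one has Û_{α₂}(y) ≤ Û_{α₁}(y); that is, Û(y) is non-increasing in the drawdown parameter α for fixed y. -/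
open Real Set

noncomputable section

/-- A function glued from three branches, with junctions at `a` and at `1`. -/
def threePiece (a : ℝ) (f g h : ℝ → ℝ) (y : ℝ) : ℝ :=
  if a ≤ y then f y else if 1 < y then g y else h y

lemma HasDerivAt.glue {F f g : ℝ → ℝ} {c x d : ℝ}
    (hf : ∀ z, c ≤ z → F z = f z) (hg : ∀ z, z ≤ c → F z = g z)
    (hf' : c ≤ x → HasDerivAt f d x) (hg' : x ≤ c → HasDerivAt g d x) : HasDerivAt F d x := by
  rcases lt_trichotomy x c with h | h | h
  · refine (hg' h.le).congr_of_eventuallyEq ?_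
    filter_upwards [Iio_mem_nhds h] with z hz using hg z (le_of_lt hz)
  · subst h
    have h1 : HasDerivWithinAt F d (Iic x) x :=
      (hg' le_rfl).hasDerivWithinAt.congr (fun z hz => hg z hz) (hg x le_rfl)
    have h2 : HasDerivWithinAt F d (Ici x) x :=
      (hf' le_rfl).hasDerivWithinAt.congr (fun z hz => hf z hz) (hf x le_rfl)
    simpa [Iic_union_Ici] using h1.union h2
  · refine (hf' h.le).congr_of_eventuallyEq ?_
    filter_upwards [Ioi_mem_nhds h] with z hz using hf z (le_of_lt hz)

lemma threePiece_hasDerivAt {a : ℝ} (ha : 1 < a) {f g h f' g' h' : ℝ → ℝ}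
    (hfg : f a = g a) (hgh : g 1 = h 1) (hfg' : f' a = g' a) (hgh' : g' 1 = h' 1)
    (hf : ∀ y, 0 < y → HasDerivAt f (f' y) y) (hg : ∀ y, 0 < y → HasDerivAt g (g' y) y)
    (hh : ∀ y, 0 < y → HasDerivAt h (h' y) y) (y : ℝ) (hy : 0 < y) :
    HasDerivAt (threePiece a f g h) (threePiece a f' g' h' y) y := by
  have left_one : ∀ u v : ℝ → ℝ, ∀ z, z ≤ 1 →
      (if 1 < z then u z else v z) = v z := fun u v z hz => if_neg (not_lt.2 hz)
  have right_one : ∀ u v : ℝ → ℝ, u 1 = v 1 → ∀ z, 1 ≤ z →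
      (if 1 < z then u z else v z) = u z := by
    intro u v huv z hz
    rcases hz.eq_or_lt with rfl | hz
    · simp [huv]
    · exact if_pos hz
  have left_kink : ∀ u v w : ℝ → ℝ, u a = v a → ∀ z, z ≤ a →
      threePiece a u v w z = (if 1 < z then v z else w z) := by
    intro u v w huv z hz
    rcases hz.eq_or_lt with rfl | hz
    · simp [threePiece, huv, ha]
    · exact if_neg (not_le.2 hz)
  refine HasDerivAt.glue (c := a) (f := f) (g := fun z => if 1 < z then g z else h z)
    (fun z hz => if_pos hz) (left_kink f g h hfg) ?_ ?_
  · intro hay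
    rw [threePiece, if_pos hay]
    exact hf y hy
  · intro hya
    rw [left_kink f' g' h' hfg' y hya]
    refine HasDerivAt.glue (c := 1) (right_one g h hgh) (left_one g h) ?_ ?_
    · intro h1
      rw [right_one g' h' hgh' y h1]
      exact hg y hy
    · intro h1
      rw [left_one g' h' y h1]
      exact hh y hy

/-- The maximizer of `c ↦ c ^ (1 - p) / (1 - p) - c * y` over `[α, 1]`. -/
def dualConsumption (p α : ℝ) : ℝ → ℝ :=
  threePiece (α ^ (-p)) (fun _ => α) (fun y => y ^ (-1 / p)) (fun _ => 1)

/-- The maximum of `c ↦ c ^ (1 - p) / (1 - p) - c * y` over `[α, 1]`. -/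
def dualUtility (p α : ℝ) : ℝ → ℝ :=
  threePiece (α ^ (-p)) (fun y => α ^ (1 - p) / (1 - p) - α * y)
    (fun y => p / (1 - p) * y ^ (-(1 - p) / p)) (fun y => 1 / (1 - p) - y)

section DualUtility

variable {p α : ℝ}

lemma one_lt_rpow_neg (hp : 0 < p) (hα : 0 < α) (hα1 : α < 1) : 1 < α ^ (-p) :=
  Real.one_lt_rpow_of_pos_of_lt_one_of_neg hα hα1 (by linarith)

lemma rpow_neg_rpow_neg_inv (hp : 0 < p) (hα : 0 < α) : (α ^ (-p)) ^ (-1 / p) = α := by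
  rw [← Real.rpow_mul hα.le]
  have : -p * (-1 / p) = 1 := by field_simp
  rw [this, Real.rpow_one]

lemma rpow_neg_rpow_neg_div (hp : 0 < p) (hα : 0 < α) :
    (α ^ (-p)) ^ (-(1 - p) / p) = α * α ^ (-p) := by
  rw [← Real.rpow_mul hα.le]
  have : -p * (-(1 - p) / p) = 1 + -p := by field_simp; ring
  rw [this, Real.rpow_add hα, Real.rpow_one]

lemma rpow_one_sub_eq (hα : 0 < α) : α ^ (1 - p) = α * α ^ (-p) := by
  rw [sub_eq_add_neg, Real.rpow_add hα, Real.rpow_one]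

lemma hasDerivAt_dualUtility (hp : 0 < p) (hp2 : p < 1) (hα : 0 < α) (hα1 : α < 1) (y : ℝ)
    (hy : 0 < y) : HasDerivAt (dualUtility p α) (-dualConsumption p α y) y := by
  have h1p : (1 - p) ≠ 0 := by linarith
  have e : -dualConsumption p α y =
      threePiece (α ^ (-p)) (fun _ => -α) (fun y => -y ^ (-1 / p)) (fun _ => -1) y := by
    unfold dualConsumption threePiece
    split_ifs <;> rfl
  rw [e]
  refine threePiece_hasDerivAt (one_lt_rpow_neg hp hα hα1) ?_ ?_ ?_ ?_ ?_ ?_ ?_ y hy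
  · simp only [rpow_neg_rpow_neg_div hp hα, rpow_one_sub_eq hα]
    field_simp
    ring
  · simp only [Real.one_rpow]
    field_simp
    ring
  · simp only [rpow_neg_rpow_neg_inv hp hα]
  · simp only [Real.one_rpow]
  · intro y _
    simpa using ((hasDerivAt_id y).const_mul α).const_sub (α ^ (1 - p) / (1 - p))
  · intro y hy
    have h := (Real.hasDerivAt_rpow_const (x := y) (p := -(1 - p) / p)
      (Or.inl hy.ne')).const_mul (p / (1 - p))
    have e1 : -(1 - p) / p - 1 = -1 / p := by field_simp; ring
    rw [e1] at h
    refine h.congr_deriv ?_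
    field_simp
  · intro y _
    simpa using (hasDerivAt_id y).const_sub (1 / (1 - p))

lemma dualConsumption_pos (hα : 0 < α) (y : ℝ) (hy : 0 < y) : 0 < dualConsumption p α y := by
  unfold dualConsumption threePiece
  split_ifs
  · exact hα
  · positivity
  · exact one_pos

lemma dualUtility_of_le_one (hp : 0 < p) (hα : 0 < α) (hα1 : α < 1) {y : ℝ} (hy : y ≤ 1) :
    dualUtility p α y = 1 / (1 - p) - y := by
  have := one_lt_rpow_neg hp hα hα1
  rw [dualUtility, threePiece, if_neg (by linarith), if_neg (by linarith)]

lemma dualConsumption_mono (hp : 0 < p) {β : ℝ} (hα : 0 < α) (hαβ : α < β)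
    (hβ1 : β < 1) (y : ℝ) : dualConsumption p α y ≤ dualConsumption p β y := by
  have hβ : 0 < β := hα.trans hαβ
  have hpow : β ^ (-p) < α ^ (-p) := Real.rpow_lt_rpow_of_neg hα hαβ (by linarith)
  unfold dualConsumption threePiece
  by_cases h1 : α ^ (-p) ≤ y
  · rw [if_pos h1, if_pos (by linarith)]
    exact hαβ.le
  · rw [if_neg h1]
    by_cases h2 : β ^ (-p) ≤ y
    · rw [if_pos h2]
      have hle : y ^ (-1 / p) ≤ β := by
        calc y ^ (-1 / p) ≤ (β ^ (-p)) ^ (-1 / p) :=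
              Real.rpow_le_rpow_of_nonpos (by positivity) h2
                (div_nonpos_of_nonpos_of_nonneg (by norm_num) hp.le)
          _ = β := rpow_neg_rpow_neg_inv hp hβ
      by_cases h3 : 1 < y
      · rwa [if_pos h3]
      · exact absurd (one_lt_rpow_neg hp hβ hβ1) (by linarith)
    · rw [if_neg h2]

end DualUtility

lemma monotoneOn_of_hasDerivAt_nonneg {f f' : ℝ → ℝ} {a b : ℝ}
    (hf : ∀ x ∈ Icc a b, HasDerivAt f (f' x) x) (hf' : ∀ x ∈ Icc a b, 0 ≤ f' x) :
    MonotoneOn f (Icc a b) :=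
  monotoneOn_of_hasDerivWithinAt_nonneg (convex_Icc a b)
    (fun x hx => (hf x hx).continuousAt.continuousWithinAt)
    (fun x hx => (hf x (interior_subset hx)).hasDerivWithinAt)
    (fun x hx => hf' x (interior_subset hx))

lemma antitoneOn_of_hasDerivAt_nonpos {f f' : ℝ → ℝ} {a b : ℝ}
    (hf : ∀ x ∈ Icc a b, HasDerivAt f (f' x) x) (hf' : ∀ x ∈ Icc a b, f' x ≤ 0) :
    AntitoneOn f (Icc a b) :=
  antitoneOn_of_hasDerivWithinAt_nonpos (convex_Icc a b)
    (fun x hx => (hf x hx).continuousAt.continuousWithinAt)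
    (fun x hx => (hf x (interior_subset hx)).hasDerivWithinAt)
    (fun x hx => hf' x (interior_subset hx))

lemma hasDerivAt_rpow_mul {f : ℝ → ℝ} {d y : ℝ} (r : ℝ) (hy : 0 < y) (hf : HasDerivAt f d y) :
    HasDerivAt (fun z => z ^ r * f z) (y ^ r * (d + r * f y / y)) y := by
  refine ((Real.hasDerivAt_rpow_const (p := r) (Or.inl hy.ne')).mul hf).congr_deriv ?_
  rw [Real.rpow_sub_one hy.ne']
  field_simp
  ring

lemma dualUtility_antitone_param {p α β : ℝ} (hp : 0 < p) (hp2 : p < 1) (hα : 0 < α)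
    (hαβ : α < β) (hβ1 : β < 1) (y : ℝ) :
    dualUtility p β y ≤ dualUtility p α y := by
  have hβ : 0 < β := hα.trans hαβ
  have hα1 : α < 1 := hαβ.trans hβ1
  rcases le_total y 1 with h | h
  · rw [dualUtility_of_le_one hp hα hα1 h, dualUtility_of_le_one hp hβ hβ1 h]
  · have hd : ∀ z, 0 < z → HasDerivAt (fun z => dualUtility p α z - dualUtility p β z)
        (-dualConsumption p α z - -dualConsumption p β z) z := fun z hz =>
      (hasDerivAt_dualUtility hp hp2 hα hα1 z hz).sub (hasDerivAt_dualUtility hp hp2 hβ hβ1 z hz)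
    have hmono := monotoneOn_of_hasDerivAt_nonneg (a := 1) (b := y)
      (fun z hz => hd z (by linarith [hz.1])) (fun z hz => by
        linarith [dualConsumption_mono hp hα hαβ hβ1 z])
    have h1 := hmono (left_mem_Icc.2 h) (right_mem_Icc.2 h) h
    simp only [dualUtility_of_le_one hp hα hα1 le_rfl, dualUtility_of_le_one hp hβ hβ1 le_rfl]
      at h1
    linarith

lemma dualUtility_antitone {p α : ℝ} (hp : 0 < p) (hp2 : p < 1) (hα : 0 < α) (hα1 : α < 1)
    {x y : ℝ} (hx : 0 < x) (hxy : x ≤ y) : dualUtility p α y ≤ dualUtility p α x :=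
  antitoneOn_of_hasDerivAt_nonpos (a := x) (b := y)
    (fun z hz => hasDerivAt_dualUtility hp hp2 hα hα1 z (by linarith [hz.1]))
    (fun z hz => by linarith [dualConsumption_pos (p := p) hα z (by linarith [hz.1])])
    (left_mem_Icc.2 hxy) (right_mem_Icc.2 hxy) hxy

/-- The free boundary problem solved by the dual function `U`, written as a first-order system for
`U` and `P = U' + κδ U / y`, with free boundaries `ys < 1` and `y0 > α ^ (-p)`. -/
structure DualSolution (κ δ p α ys y0 : ℝ) (U P : ℝ → ℝ) : Prop where
  κ_pos : 0 < κ
  δ_pos : 0 < δ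
  p_pos : 0 < p
  p_lt : p < 1
  q_pos : 0 < p * (1 + κ * δ) - 1
  α_pos : 0 < α
  α_lt : α < 1
  ys_pos : 0 < ys
  ys_lt : ys < 1
  lt_y0 : α ^ (-p) < y0
  derivU : ∀ y, 0 < y → HasDerivAt U (P y - κ * δ * U y / y) y
  derivP : ∀ y, 0 < y → HasDerivAt P (-(κ * dualUtility p α y / y ^ 2)) y
  U_y0 : U y0 = 0
  P_y0 : P y0 = 0
  P_ys : ys * P ys = p * κ * dualUtility p α ys
  U_ys : (p * (1 + κ * δ) - 1) * U ys = p * (ys * P ys)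

namespace DualSolution

variable {κ δ p α ys y0 : ℝ} {U P : ℝ → ℝ}

/-- The function `G = (1 - p) U + p y U'`, up to the first-order system. -/
def G (κ δ p : ℝ) (U P : ℝ → ℝ) (y : ℝ) : ℝ := p * (y * P y) - (p * (1 + κ * δ) - 1) * U y

/-- The function `G' + κδ G / y`. -/
def R (κ p α : ℝ) (P : ℝ → ℝ) (y : ℝ) : ℝ := P y - p * κ * dualUtility p α y / y

lemma one_lt_kink (S : DualSolution κ δ p α ys y0 U P) : 1 < α ^ (-p) :=
  one_lt_rpow_neg S.p_pos S.α_pos S.α_lt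

lemma hasDerivAt_rpow_mul_U (S : DualSolution κ δ p α ys y0 U P) (y : ℝ) (hy : 0 < y) :
    HasDerivAt (fun z => z ^ (κ * δ) * U z) (y ^ (κ * δ) * P y) y := by
  refine (hasDerivAt_rpow_mul (κ * δ) hy (S.derivU y hy)).congr_deriv ?_
  ring

lemma hasDerivAt_rpow_mul_G (S : DualSolution κ δ p α ys y0 U P) (y : ℝ) (hy : 0 < y) :
    HasDerivAt (fun z => z ^ (κ * δ) * G κ δ p U P z) (y ^ (κ * δ) * R κ p α P y) y := by
  have h : HasDerivAt (G κ δ p U P) _ y :=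
    ((((hasDerivAt_id y).mul (S.derivP y hy)).const_mul p).sub
      ((S.derivU y hy).const_mul (p * (1 + κ * δ) - 1)))
  refine (hasDerivAt_rpow_mul (κ * δ) hy h).congr_deriv ?_
  simp only [G, R, id]
  field_simp
  ring

lemma hasDerivAt_R (S : DualSolution κ δ p α ys y0 U P) (y : ℝ) (hy : 0 < y) :
    HasDerivAt (R κ p α P) (-(κ * ((1 - p) * dualUtility p α y -
      p * y * dualConsumption p α y) / y ^ 2)) y := by
  have h : HasDerivAt (R κ p α P) _ y := (S.derivP y hy).sub
    (((hasDerivAt_dualUtility S.p_pos S.p_lt S.α_pos S.α_lt y hy).const_mul (p * κ)).div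
      (hasDerivAt_id y) hy.ne')
  refine h.congr_deriv ?_
  field_simp
  ring

lemma R_ys (S : DualSolution κ δ p α ys y0 U P) : R κ p α P ys = 0 := by
  have := S.ys_pos
  have h := S.P_ys
  rw [R, ← h]
  field_simp
  ring

lemma G_ys (S : DualSolution κ δ p α ys y0 U P) : G κ δ p U P ys = 0 := by
  rw [G, S.U_ys, sub_self]

lemma G_y0 (S : DualSolution κ δ p α ys y0 U P) : G κ δ p U P y0 = 0 := by
  rw [G, S.U_y0, S.P_y0]
  ring

lemma R_antitoneOn (S : DualSolution κ δ p α ys y0 U P) :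
    AntitoneOn (R κ p α P) (Icc ys (α ^ (-p))) := by
  have hys := S.ys_pos
  have hp := S.p_pos
  have hp2 : 0 < 1 - p := by linarith [S.p_lt]
  refine antitoneOn_of_hasDerivAt_nonpos
    (fun y hy => S.hasDerivAt_R y (by linarith [hy.1])) (fun y hy => ?_)
  have hy0 : 0 < y := by linarith [hy.1]
  have hκ := S.κ_pos
  have key : 0 ≤ (1 - p) * dualUtility p α y - p * y * dualConsumption p α y := by
    rcases hy.2.eq_or_lt with h | h
    · rw [dualUtility, dualConsumption, threePiece, threePiece, if_pos h.ge, if_pos h.ge,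
        rpow_one_sub_eq S.α_pos, ← h]
      apply le_of_eq
      field_simp
      ring
    · rw [dualUtility, dualConsumption, threePiece, threePiece, if_neg (not_le.2 h),
        if_neg (not_le.2 h)]
      split_ifs with h1
      · have e : -(1 - p) / p = -1 / p + 1 := by field_simp; ring
        rw [e, Real.rpow_add hy0, Real.rpow_one]
        apply le_of_eq
        field_simp
        ring
      · have e : (1 - p) * (1 / (1 - p) - y) - p * y * 1 = 1 - y := by field_simp; ring
        rw [e]
        linarith
  have : 0 ≤ κ * ((1 - p) * dualUtility p α y - p * y * dualConsumption p α y) / y ^ 2 := by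
    positivity
  linarith

lemma R_monotoneOn (S : DualSolution κ δ p α ys y0 U P) :
    MonotoneOn (R κ p α P) (Icc (α ^ (-p)) y0) := by
  have ha := S.one_lt_kink
  have hα := S.α_pos
  have hp2 : 0 < 1 - p := by linarith [S.p_lt]
  refine monotoneOn_of_hasDerivAt_nonneg
    (fun y hy => S.hasDerivAt_R y (by linarith [hy.1])) (fun y hy => ?_)
  have hκ := S.κ_pos
  have hy0 : 0 < y := by linarith [hy.1]
  rw [dualUtility, dualConsumption, threePiece, threePiece, if_pos hy.1, if_pos hy.1,
    rpow_one_sub_eq S.α_pos]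
  have e : -(κ * ((1 - p) * (α * α ^ (-p) / (1 - p) - α * y) - p * y * α) / y ^ 2) =
      κ * α * (y - α ^ (-p)) / y ^ 2 := by
    field_simp
    ring
  rw [e]
  have : 0 ≤ y - α ^ (-p) := by linarith [hy.1]
  positivity

lemma R_nonpos (S : DualSolution κ δ p α ys y0 U P) {y : ℝ} (h1 : ys ≤ y) (h2 : y ≤ α ^ (-p)) :
    R κ p α P y ≤ 0 := by
  rw [← S.R_ys]
  exact S.R_antitoneOn ⟨le_rfl, h1.trans h2⟩ ⟨h1, h2⟩ h1

lemma G_nonpos (S : DualSolution κ δ p α ys y0 U P) {y : ℝ} (h1 : ys ≤ y) (h2 : y ≤ y0) :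
    G κ δ p U P y ≤ 0 := by
  have hys := S.ys_pos
  have hy0 : 0 < y := by linarith
  have ha := S.one_lt_kink
  have hyk : 0 < y ^ (κ * δ) := by positivity
  suffices h : y ^ (κ * δ) * G κ δ p U P y ≤ 0 from nonpos_of_mul_nonpos_right h hyk
  by_cases hR : R κ p α P y ≤ 0
  · have hanti := antitoneOn_of_hasDerivAt_nonpos (a := ys) (b := y)
      (fun z hz => S.hasDerivAt_rpow_mul_G z (by linarith [hz.1])) (fun z hz => by
        have hz0 : 0 < z := by linarith [hz.1]
        refine mul_nonpos_of_nonneg_of_nonpos (by positivity) ?_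
        rcases le_total z (α ^ (-p)) with h | h
        · exact S.R_nonpos hz.1 h
        · exact (S.R_monotoneOn ⟨h, hz.2.trans h2⟩ ⟨h.trans hz.2, h2⟩ hz.2).trans hR)
    have := hanti (left_mem_Icc.2 h1) (right_mem_Icc.2 h1) h1
    simpa [S.G_ys] using this
  · have hya : α ^ (-p) < y := by
      by_contra hc
      exact hR (S.R_nonpos h1 (not_lt.1 hc))
    have hmono := monotoneOn_of_hasDerivAt_nonneg (a := y) (b := y0)
      (fun z hz => S.hasDerivAt_rpow_mul_G z (by linarith [hz.1])) (fun z hz => by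
        have hz0 : 0 < z := by linarith [hz.1]
        refine mul_nonneg (by positivity) ?_
        exact (not_le.1 hR).le.trans
          (S.R_monotoneOn ⟨hya.le, h2⟩ ⟨hya.le.trans hz.1, hz.2⟩ hz.1))
    have := hmono (left_mem_Icc.2 h2) (right_mem_Icc.2 h2) h2
    simpa [S.G_y0] using this

lemma dualUtility_y0_nonpos (S : DualSolution κ δ p α ys y0 U P) : dualUtility p α y0 ≤ 0 := by
  have ha := S.one_lt_kink
  have hlt := S.lt_y0
  have hy0 : 0 < y0 := by linarith
  have hys := S.ys_pos
  by_contra! hV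
  have hR0 : R κ p α P y0 < 0 := by
    have hp := S.p_pos
    have hκ := S.κ_pos
    rw [R, S.P_y0, zero_sub, neg_lt_zero]
    positivity
  have hanti : StrictAntiOn (fun z => z ^ (κ * δ) * G κ δ p U P z) (Icc (α ^ (-p)) y0) := by
    refine strictAntiOn_of_hasDerivWithinAt_neg
      (f' := fun y => y ^ (κ * δ) * R κ p α P y) (convex_Icc _ _)
      (fun z hz => (S.hasDerivAt_rpow_mul_G z (by linarith [hz.1])).continuousAt.continuousWithinAt)
      (fun z hz => (S.hasDerivAt_rpow_mul_G z
        (by linarith [(interior_subset hz).1])).hasDerivWithinAt) (fun z hz => ?_)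
    have hz' := interior_subset hz
    have hz0 : 0 < z := by linarith [hz'.1]
    exact mul_neg_of_pos_of_neg (by positivity)
      ((S.R_monotoneOn hz' (right_mem_Icc.2 hlt.le) hz'.2).trans_lt hR0)
  have h := hanti (left_mem_Icc.2 hlt.le) (right_mem_Icc.2 hlt.le) hlt
  simp only [S.G_y0, mul_zero] at h
  have hk : 0 < (α ^ (-p)) ^ (κ * δ) := by positivity
  have hG := S.G_nonpos (y := α ^ (-p)) (by linarith [S.ys_lt]) hlt.le
  exact absurd h (not_lt.2 (mul_nonpos_of_nonneg_of_nonpos hk.le hG))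

lemma U_nonneg (S : DualSolution κ δ p α ys y0 U P) {y : ℝ} (h1 : ys ≤ y) (h2 : y ≤ y0) :
    0 ≤ U y := by
  have hys := S.ys_pos
  have hp := S.p_pos
  have hy0 : 0 < y := by linarith
  have hanti := antitoneOn_of_hasDerivAt_nonpos (a := y) (b := y0)
    (fun z hz => hasDerivAt_rpow_mul ((1 - p) / p) (by linarith [hz.1])
      (S.derivU z (by linarith [hz.1]))) (fun z hz => by
        have hz0 : 0 < z := by linarith [hz.1]
        have e : P z - κ * δ * U z / z + (1 - p) / p * U z / z = G κ δ p U P z / (p * z) := by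
          rw [G]
          field_simp
          ring
        rw [e]
        exact mul_nonpos_of_nonneg_of_nonpos (by positivity)
          (div_nonpos_of_nonpos_of_nonneg (S.G_nonpos (h1.trans hz.1) hz.2) (by positivity)))
  have h := hanti (left_mem_Icc.2 h2) (right_mem_Icc.2 h2) h2
  simp only [S.U_y0, mul_zero] at h
  exact nonneg_of_mul_nonneg_right h (by positivity)

lemma U_ys_eq (S : DualSolution κ δ p α ys y0 U P) :
    (p * (1 + κ * δ) - 1) * U ys = p ^ 2 * κ * (1 / (1 - p) - ys) := by
  rw [S.U_ys, S.P_ys, dualUtility_of_le_one S.p_pos S.α_pos S.α_lt S.ys_lt.le]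
  ring

lemma U_le_of_le_one (S : DualSolution κ δ p α ys y0 U P) {y : ℝ} (h1 : ys ≤ y) (h2 : y ≤ 1) :
    (p * (1 + κ * δ) - 1) * U y ≤ p ^ 2 * κ * (1 / (1 - p) - y) := by
  have hys := S.ys_pos
  have hp := S.p_pos
  have hκ := S.κ_pos
  have hq := S.q_pos
  have ha := S.one_lt_kink
  have hp2 : 0 < 1 - p := by linarith [S.p_lt]
  have hy0 : 0 < y := by linarith
  have hmono := monotoneOn_of_hasDerivAt_nonneg (a := ys) (b := y)
    (fun z hz => hasDerivAt_rpow_mul (κ * δ) (by linarith [hz.1])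
      ((((hasDerivAt_id z).const_sub (1 / (1 - p))).const_mul (p ^ 2 * κ)).sub
        ((S.derivU z (by linarith [hz.1])).const_mul (p * (1 + κ * δ) - 1)))) (fun z hz => by
        have hz0 : 0 < z := by linarith [hz.1]
        have hz1 : z ≤ 1 := hz.2.trans h2
        have hR := S.R_nonpos hz.1 (by linarith)
        have e : p ^ 2 * κ * -1 - (p * (1 + κ * δ) - 1) * (P z - κ * δ * U z / z) +
            κ * δ * (p ^ 2 * κ * (1 / (1 - p) - z) - (p * (1 + κ * δ) - 1) * U z) / z =
            (p * (1 + κ * δ) - 1) * (-R κ p α P z) + p * κ * (1 - z) / z := by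
          rw [R, dualUtility_of_le_one hp S.α_pos S.α_lt hz1]
          field_simp
          ring
        refine mul_nonneg (by positivity) (e.ge.trans' ?_)
        have h3 : 0 ≤ -R κ p α P z := by linarith
        have h4 : 0 ≤ 1 - z := by linarith
        positivity)
  have h := hmono (left_mem_Icc.2 h1) (right_mem_Icc.2 h1) h1
  simp only [Pi.sub_apply, id, S.U_ys_eq, sub_self, mul_zero] at h
  have := nonneg_of_mul_nonneg_right h (by positivity)
  linarith

/-- Comparison principle: the dual function is non-increasing in the drawdown parameter. -/
theorem comparison {α₁ α₂ y₁ y₂ b₁ b₂ : ℝ} {U₁ P₁ U₂ P₂ : ℝ → ℝ}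
    (S₁ : DualSolution κ δ p α₁ y₁ b₁ U₁ P₁) (S₂ : DualSolution κ δ p α₂ y₂ b₂ U₂ P₂)
    (h12 : α₁ < α₂) {y : ℝ} (hy₁ : y ∈ Ioo y₁ b₁) (hy₂ : y ∈ Ioo y₂ b₂) : U₂ y ≤ U₁ y := by
  have hκ := S₁.κ_pos
  have hp := S₁.p_pos
  have hq := S₁.q_pos
  have hp2 := S₁.p_lt
  have hy₁0 := S₁.ys_pos
  have hy₂0 := S₂.ys_pos
  have hy0 : 0 < y := hy₁0.trans hy₁.1
  -- the weighted difference is concave in the variable `y ^ (1 + κ * δ)`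
  have hP : ∀ u v, 0 < u → u ≤ v → P₁ v - P₂ v ≤ P₁ u - P₂ u := fun u v hu huv =>
    antitoneOn_of_hasDerivAt_nonpos (a := u) (b := v)
      (fun z hz => (S₁.derivP z (by linarith [hz.1])).sub (S₂.derivP z (by linarith [hz.1])))
      (fun z hz => by
        have hz0 : 0 < z := by linarith [hz.1]
        have hV := dualUtility_antitone_param hp hp2 S₁.α_pos h12 S₂.α_lt z
        have : κ * dualUtility p α₂ z / z ^ 2 ≤ κ * dualUtility p α₁ z / z ^ 2 := by gcongr
        linarith)
      (left_mem_Icc.2 huv) (right_mem_Icc.2 huv) huv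
  have hE : ∀ z, 0 < z → HasDerivAt (fun z => z ^ (κ * δ) * (U₁ z - U₂ z))
      (z ^ (κ * δ) * (P₁ z - P₂ z)) z := fun z hz => by
    have h := (S₁.hasDerivAt_rpow_mul_U z hz).sub (S₂.hasDerivAt_rpow_mul_U z hz)
    refine (h.congr_deriv (by ring)).congr_of_eventuallyEq (Filter.Eventually.of_forall ?_)
    intro x
    simp only [Pi.sub_apply]
    ring
  have fall : ∀ u v, 0 < u → u ≤ v → P₁ u - P₂ u < 0 → U₁ u - U₂ u < 0 →
      P₁ v - P₂ v < 0 ∧ U₁ v - U₂ v < 0 := fun u v hu huv hPu hUu => by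
    refine ⟨(hP u v hu huv).trans_lt hPu, ?_⟩
    have hanti := antitoneOn_of_hasDerivAt_nonpos (a := u) (b := v)
      (fun z hz => hE z (by linarith [hz.1])) (fun z hz => by
        have hz0 : 0 < z := by linarith [hz.1]
        exact mul_nonpos_of_nonneg_of_nonpos (by positivity)
          ((hP u z hu hz.1).trans hPu.le))
    have h := hanti (left_mem_Icc.2 huv) (right_mem_Icc.2 huv) huv
    have hu' : 0 < u ^ (κ * δ) := by positivity
    have hv' : 0 < v ^ (κ * δ) := Real.rpow_pos_of_pos (hu.trans_le huv) _
    have h2 : v ^ (κ * δ) * (U₁ v - U₂ v) < 0 := h.trans_lt (mul_neg_of_pos_of_neg hu' hUu)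
    exact neg_of_mul_neg_right h2 hv'.le
  by_contra! hneg
  -- right end
  obtain ⟨b, hyb, hb⟩ : ∃ b, y ≤ b ∧ ¬ (P₁ b - P₂ b < 0 ∧ U₁ b - U₂ b < 0) := by
    rcases le_total b₂ b₁ with h | h
    · refine ⟨b₂, hy₂.2.le, fun hc => ?_⟩
      have := S₁.U_nonneg (y := b₂) (hy₁.1.le.trans hy₂.2.le) h
      rw [S₂.U_y0] at hc
      linarith [hc.2]
    · refine ⟨b₁, hy₁.2.le, fun hc => ?_⟩
      have hb₁ : 0 < b₁ := hy0.trans hy₁.2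
      have hmono := monotoneOn_of_hasDerivAt_nonneg (a := b₁) (b := b₂)
        (fun z hz => S₂.derivP z (by linarith [hz.1])) (fun z hz => by
          have hz0 : 0 < z := by linarith [hz.1]
          have hV : dualUtility p α₂ z ≤ 0 :=
            (dualUtility_antitone_param hp hp2 S₁.α_pos h12 S₂.α_lt z).trans
              ((dualUtility_antitone hp hp2 S₁.α_pos S₁.α_lt hb₁ hz.1).trans
                S₁.dualUtility_y0_nonpos)
          rw [neg_nonneg]
          exact div_nonpos_of_nonpos_of_nonneg
            (mul_nonpos_of_nonneg_of_nonpos hκ.le hV) (by positivity))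
      have h' := hmono (left_mem_Icc.2 h) (right_mem_Icc.2 h) h
      rw [S₂.P_y0] at h'
      rw [S₁.P_y0] at hc
      linarith [hc.1]
  -- left end
  obtain ⟨a, ha0, hay, ha⟩ : ∃ a, 0 < a ∧ a ≤ y ∧
      (U₁ a - U₂ a < 0 → P₁ a - P₂ a < 0) := by
    rcases le_total y₁ y₂ with h | h
    · refine ⟨y₂, hy₂0, hy₂.1.le, fun hc => ?_⟩
      have hG := S₁.G_nonpos h (hy₂.1.le.trans hy₁.2.le)
      have hG2 := S₂.G_ys
      rw [G] at hG hG2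
      have h1 := mul_neg_of_pos_of_neg hq hc
      have h2 : p * y₂ * (P₁ y₂ - P₂ y₂) < 0 := by linarith
      exact neg_of_mul_neg_right h2 (by positivity)
    · refine ⟨y₁, hy₁0, hy₁.1.le, fun hc => ?_⟩
      have h1 := S₂.U_le_of_le_one h S₁.ys_lt.le
      rw [← S₁.U_ys_eq] at h1
      linarith [le_of_mul_le_mul_left h1 hq]
  have hUy : U₁ y - U₂ y < 0 := by linarith
  refine hb (fall y b hy0 hyb ?_ hUy)
  by_cases hUa : U₁ a - U₂ a < 0
  · exact (fall a y ha0 hay (ha hUa) hUa).1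
  · by_contra! hPy
    have hmono := monotoneOn_of_hasDerivAt_nonneg (a := a) (b := y)
      (fun z hz => hE z (by linarith [hz.1])) (fun z hz => by
        have hz0 : 0 < z := by linarith [hz.1]
        exact mul_nonneg (by positivity) (hPy.trans (hP z y hz0 hz.2)))
    have h := hmono (left_mem_Icc.2 hay) (right_mem_Icc.2 hay) hay
    have h1 : 0 ≤ a ^ (κ * δ) * (U₁ a - U₂ a) :=
      mul_nonneg (by positivity) (not_lt.1 hUa)
    have h2 : y ^ (κ * δ) * (U₁ y - U₂ y) < 0 :=
      mul_neg_of_pos_of_neg (by positivity) hUy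
    exact absurd (h1.trans h) (not_le.2 h2)

end DualSolution

/-- The function `U' + κδ U / y` for `U = Uhat κ δ p α η`. -/
def dualSlope (κ δ p α η : ℝ) : ℝ → ℝ :=
  threePiece (α ^ (-p))
    (fun y => (1 + κ * δ) * C1 κ δ p α η + κ * α * (Real.log y + 1 / (1 + κ * δ)) +
      κ * α ^ (1 - p) / (1 - p) / y)
    (fun y => (1 + κ * δ) * C3 κ δ p α η + κ * p ^ 2 / (1 - p) * y ^ (-1 / p))
    (fun y => (1 + κ * δ) * C5 κ δ p α η + κ * (Real.log y + 1 / (1 + κ * δ)) +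
      κ / (1 - p) / y)

lemma Uhat_eq_threePiece (κ δ p α η : ℝ) :
    Uhat κ δ p α η = threePiece (α ^ (-p))
      (fun y => C1 κ δ p α η * y + C2 κ δ p α η * y ^ (-(κ * δ)) +
        κ * α / (1 + κ * δ) * (y * Real.log y) + α ^ (1 - p) / (δ * (1 - p)))
      (fun y => C3 κ δ p α η * y + C4 κ δ p α η * y ^ (-(κ * δ)) +
        κ * p ^ 3 / ((1 - p) * (p * (1 + κ * δ) - 1)) * y ^ (-(1 - p) / p))
      (fun y => C5 κ δ p α η * y + C6 κ δ p α η * y ^ (-(κ * δ)) +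
        κ / (1 + κ * δ) * (y * Real.log y) + 1 / (δ * (1 - p))) := rfl

lemma hasDerivAt_linear_add_rpow (A B k y : ℝ) (hy : 0 < y) :
    HasDerivAt (fun y => A * y + B * y ^ (-k)) (A - k * (B * y ^ (-k)) / y) y := by
  refine (((hasDerivAt_id y).const_mul A).add
    ((Real.hasDerivAt_rpow_const (p := -k) (Or.inl hy.ne')).const_mul B)).congr_deriv ?_
  rw [Real.rpow_sub_one hy.ne']
  field_simp
  ring

lemma hasDerivAt_log_branch (A B D E k y : ℝ) (hy : 0 < y) (hk : 1 + k ≠ 0) :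
    HasDerivAt (fun y => A * y + B * y ^ (-k) + D / (1 + k) * (y * Real.log y) + E)
      ((1 + k) * A + D * (Real.log y + 1 / (1 + k)) + k * E / y -
        k * (A * y + B * y ^ (-k) + D / (1 + k) * (y * Real.log y) + E) / y) y := by
  refine (((hasDerivAt_linear_add_rpow A B k y hy).add
    ((Real.hasDerivAt_mul_log hy.ne').const_mul (D / (1 + k)))).add_const E).congr_deriv ?_
  field_simp
  ring

lemma rpow_neg_rpow_mul {α p k : ℝ} (hα : 0 < α) :
    α ^ (1 - p * (1 + k)) * (α ^ (-p)) ^ (-k) = α * α ^ (-p) := by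
  rw [← Real.rpow_mul hα.le, ← Real.rpow_add hα, ← rpow_one_sub_eq hα]
  congr 1
  ring

section Solution

variable {κ δ p α η : ℝ}

lemma hasDerivAt_dualSlope (hp : 0 < p) (hp2 : p < 1) (hκ : 0 < κ)
    (hδ : 0 < δ) (hα : 0 < α) (hα1 : α < 1) (hη : 1 < η) (y : ℝ) (hy : 0 < y) :
    HasDerivAt (dualSlope κ δ p α η) (-(κ * dualUtility p α y / y ^ 2)) y := by
  have h1p : (1 - p) ≠ 0 := by linarith
  have hm : 1 + κ * δ ≠ 0 := by positivity
  have ha := one_lt_rpow_neg hp hα hα1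
  have hη0 : η ≠ 0 := by positivity
  have e : -(κ * dualUtility p α y / y ^ 2) = threePiece (α ^ (-p))
      (fun y => -(κ * (α ^ (1 - p) / (1 - p) - α * y) / y ^ 2))
      (fun y => -(κ * (p / (1 - p) * y ^ (-(1 - p) / p)) / y ^ 2))
      (fun y => -(κ * (1 / (1 - p) - y) / y ^ 2)) y := by
    unfold dualUtility threePiece
    split_ifs <;> rfl
  rw [e]
  have hlog : ∀ A D E B y : ℝ, 0 < y → HasDerivAt (fun y => A + D * (Real.log y + B) + E / y)
      (-((E - D * y) / y ^ 2)) y := by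
    intro A D E B y hy
    refine ((((Real.hasDerivAt_log hy.ne').add_const B).const_mul D).const_add A |>.add
      ((hasDerivAt_inv hy.ne').const_mul E)).congr_deriv ?_
    field_simp
    ring
  refine threePiece_hasDerivAt ha ?_ ?_ ?_ ?_ ?_ ?_ ?_ y hy
  · simp only [rpow_neg_rpow_neg_inv hp hα, rpow_one_sub_eq hα, Real.log_rpow hα, C1, C3]
    field_simp
    ring
  · simp only [Real.one_rpow, Real.log_one, C3, C5]
    field_simp
    ring
  · simp only [rpow_neg_rpow_neg_div hp hα, rpow_one_sub_eq hα]
    field_simp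
    ring
  · simp only [Real.one_rpow]
    field_simp
    ring
  · intro y hy
    refine (hlog _ _ _ _ y hy).congr_deriv ?_
    field_simp
  · intro y hy
    refine (((Real.hasDerivAt_rpow_const (p := -1 / p) (Or.inl hy.ne')).const_mul
      (κ * p ^ 2 / (1 - p))).const_add _).congr_deriv ?_
    have e : -(1 - p) / p = -1 / p + 1 := by field_simp; ring
    rw [e, Real.rpow_sub_one hy.ne', Real.rpow_add_one hy.ne']
    field_simp
  · intro y hy
    refine (hlog _ _ _ _ y hy).congr_deriv ?_
    field_simp

lemma hasDerivAt_Uhat (hp : 0 < p) (hp2 : p < 1) (hκ : 0 < κ)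
    (hδ : 0 < δ) (hq : 0 < p * (1 + κ * δ) - 1) (hα : 0 < α) (hα1 : α < 1) (hη : 1 < η)
    (y : ℝ) (hy : 0 < y) :
    HasDerivAt (Uhat κ δ p α η)
      (dualSlope κ δ p α η y - κ * δ * Uhat κ δ p α η y / y) y := by
  have h1p : (1 - p) ≠ 0 := by linarith
  have hm : 1 + κ * δ ≠ 0 := by positivity
  have ha := one_lt_rpow_neg hp hα hα1
  have hη0 : η ≠ 0 := by positivity
  have hq' : (1 + κ * δ) * p - 1 ≠ 0 := by
    rw [mul_comm]
    exact hq.ne'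
  have e : dualSlope κ δ p α η y - κ * δ * Uhat κ δ p α η y / y = threePiece (α ^ (-p))
      (fun y => (1 + κ * δ) * C1 κ δ p α η + κ * α * (Real.log y + 1 / (1 + κ * δ)) +
        κ * α ^ (1 - p) / (1 - p) / y - κ * δ * (C1 κ δ p α η * y +
        C2 κ δ p α η * y ^ (-(κ * δ)) + κ * α / (1 + κ * δ) * (y * Real.log y) +
        α ^ (1 - p) / (δ * (1 - p))) / y)
      (fun y => (1 + κ * δ) * C3 κ δ p α η + κ * p ^ 2 / (1 - p) * y ^ (-1 / p) -
        κ * δ * (C3 κ δ p α η * y + C4 κ δ p α η * y ^ (-(κ * δ)) +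
        κ * p ^ 3 / ((1 - p) * (p * (1 + κ * δ) - 1)) * y ^ (-(1 - p) / p)) / y)
      (fun y => (1 + κ * δ) * C5 κ δ p α η + κ * (Real.log y + 1 / (1 + κ * δ)) +
        κ / (1 - p) / y - κ * δ * (C5 κ δ p α η * y +
        C6 κ δ p α η * y ^ (-(κ * δ)) + κ / (1 + κ * δ) * (y * Real.log y) +
        1 / (δ * (1 - p))) / y) y := by
    unfold dualSlope Uhat threePiece
    split_ifs <;> rfl
  have hU1 : ∀ X, α ^ (1 - p * (1 + κ * δ)) / (1 + κ * δ) * X * (α ^ (-p)) ^ (-(κ * δ)) =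
      α * α ^ (-p) / (1 + κ * δ) * X := fun X => by
    rw [← rpow_neg_rpow_mul (k := κ * δ) hα]
    ring
  have hUa : C1 κ δ p α η * α ^ (-p) + C2 κ δ p α η * (α ^ (-p)) ^ (-(κ * δ)) +
        κ * α / (1 + κ * δ) * (α ^ (-p) * Real.log (α ^ (-p))) + α ^ (1 - p) / (δ * (1 - p)) =
      C3 κ δ p α η * α ^ (-p) + C4 κ δ p α η * (α ^ (-p)) ^ (-(κ * δ)) +
        κ * p ^ 3 / ((1 - p) * (p * (1 + κ * δ) - 1)) * (α ^ (-p)) ^ (-(1 - p) / p) := by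
    rw [C2, C4, hU1, hU1, rpow_neg_rpow_neg_div hp hα, rpow_one_sub_eq hα, Real.log_rpow hα,
      C1, C3]
    generalize κ * η ^ (1 + κ * δ) / (1 + κ * δ) - η ^ (κ * δ) / (δ * (1 - p)) = X
    field_simp
    ring
  have hUone : C3 κ δ p α η * 1 + C4 κ δ p α η * 1 ^ (-(κ * δ)) +
        κ * p ^ 3 / ((1 - p) * (p * (1 + κ * δ) - 1)) * 1 ^ (-(1 - p) / p) =
      C5 κ δ p α η * 1 + C6 κ δ p α η * 1 ^ (-(κ * δ)) +
        κ / (1 + κ * δ) * (1 * Real.log 1) + 1 / (δ * (1 - p)) := by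
    rw [C6, C2, C4, C3, C5, Real.one_rpow, Real.one_rpow, Real.log_one]
    generalize κ * η ^ (1 + κ * δ) / (1 + κ * δ) - η ^ (κ * δ) / (δ * (1 - p)) = X
    generalize α ^ (1 - p * (1 + κ * δ)) = β
    field_simp
    ring
  rw [e, Uhat_eq_threePiece]
  refine threePiece_hasDerivAt ha hUa hUone ?_ ?_ ?_ ?_ ?_ y hy
  · rw [hUa, rpow_neg_rpow_neg_inv hp hα, rpow_one_sub_eq hα, Real.log_rpow hα, C1, C3]
    congr 1
    field_simp
    ring
  · rw [hUone, Real.one_rpow, Real.log_one, C3, C5]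
    congr 1
    field_simp
    ring
  · intro y hy
    refine (hasDerivAt_log_branch _ _ _ _ _ y hy hm).congr_deriv ?_
    congr 2
    field_simp
  · intro y hy
    refine ((hasDerivAt_linear_add_rpow _ _ _ y hy).add
      ((Real.hasDerivAt_rpow_const (p := -(1 - p) / p) (Or.inl hy.ne')).const_mul
        (κ * p ^ 3 / ((1 - p) * (p * (1 + κ * δ) - 1))))).congr_deriv ?_
    have e1 : -(1 - p) / p = -1 / p + 1 := by field_simp; ring
    rw [e1, Real.rpow_sub_one hy.ne', Real.rpow_add_one hy.ne']
    field_simp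
    ring
  · intro y hy
    refine (hasDerivAt_log_branch _ _ _ _ _ y hy hm).congr_deriv ?_
    congr 2
    field_simp

lemma dualSolution_Uhat {ys : ℝ} (hp : 0 < p) (hp2 : p < 1) (hκ : 0 < κ)
    (hδ : 0 < δ) (hq : 0 < p * (1 + κ * δ) - 1) (hα : 0 < α) (hα1 : α < 1) (hη : 1 < η)
    (hys : ys ∈ Ioo (0 : ℝ) 1) (hS : SystemS κ δ p α ys η) :
    DualSolution κ δ p α ys (η * α ^ (-p)) (Uhat κ δ p α η) (dualSlope κ δ p α η) := by
  obtain ⟨hE1, hE2⟩ := hS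
  obtain ⟨hys0, hys1⟩ := hys
  have h1p : (1 - p) ≠ 0 := by linarith
  have hm : 1 + κ * δ ≠ 0 := by positivity
  have ha := one_lt_rpow_neg hp hα hα1
  have ha0 : 0 < α ^ (-p) := by linarith
  have hη0 : 0 < η := by positivity
  have hlt : α ^ (-p) < η * α ^ (-p) := by nlinarith
  have hq' : (1 + κ * δ) * p - 1 ≠ 0 := by
    rw [mul_comm]
    exact hq.ne'
  have hP : dualSlope κ δ p α η ys = p * κ * (1 / (1 - p) - ys) / ys := by
    rw [dualSlope, threePiece, if_neg (by linarith), if_neg (by linarith), C5]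
    have : α * Real.log η + α / (η * (1 - p)) = α * (1 + p) - 1 + Real.log ys + 1 / ys := by
      linarith
    rw [this]
    field_simp
    ring
  refine ⟨hκ, hδ, hp, hp2, hq, hα, hα1, hys0, hys1, hlt,
    hasDerivAt_Uhat hp hp2 hκ hδ hq hα hα1 hη,
    hasDerivAt_dualSlope hp hp2 hκ hδ hα hα1 hη, ?_, ?_, ?_, ?_⟩
  · have e : α ^ (1 - p * (1 + κ * δ)) * (η * α ^ (-p)) ^ (-(κ * δ)) =
        α * α ^ (-p) / η ^ (κ * δ) := by
      rw [Real.mul_rpow hη0.le ha0.le, Real.rpow_neg hη0.le, mul_left_comm,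
        rpow_neg_rpow_mul hα]
      field_simp
    have e2 : C2 κ δ p α η * (η * α ^ (-p)) ^ (-(κ * δ)) =
        α * α ^ (-p) / (1 + κ * δ) * (κ * η / (1 + κ * δ) - 1 / (δ * (1 - p))) := by
      calc C2 κ δ p α η * (η * α ^ (-p)) ^ (-(κ * δ)) =
          (α ^ (1 - p * (1 + κ * δ)) * (η * α ^ (-p)) ^ (-(κ * δ))) / (1 + κ * δ) *
          (κ * η ^ (1 + κ * δ) / (1 + κ * δ) - η ^ (κ * δ) / (δ * (1 - p))) := by
            rw [C2]
            ring
        _ = _ := by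
            have hηk : 0 < η ^ (κ * δ) := by positivity
            rw [e, Real.rpow_one_add' hη0.le hm]
            field_simp
    rw [Uhat, if_pos hlt.le, e2, C1, Real.log_mul hη0.ne' ha0.ne', Real.log_rpow hα,
      rpow_one_sub_eq hα]
    field_simp
    ring
  · rw [dualSlope, threePiece, if_pos hlt.le, C1, Real.log_mul hη0.ne' ha0.ne',
      Real.log_rpow hα, rpow_one_sub_eq hα]
    field_simp
    ring
  · rw [hP, dualUtility_of_le_one hp hα hα1 hys1.le]
    field_simp
  · have hC6 : C6 κ δ p α η * ys ^ (-(κ * δ)) =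
        (1 / δ - κ * ys / (1 + κ * δ)) / ((1 + κ * δ) * (p * (1 + κ * δ) - 1)) := by
      have hyk : 0 < ys ^ (κ * δ) := by positivity
      have h6 : (1 + κ * δ) * (p * (1 + κ * δ) - 1) * C6 κ δ p α η =
          ys ^ (κ * δ) / δ - κ * ys ^ (1 + κ * δ) / (1 + κ * δ) := by
        have e : (1 + κ * δ) * (p * (1 + κ * δ) - 1) * C6 κ δ p α η =
          α ^ (1 - p * (1 + κ * δ)) * (p * (1 + κ * δ) - 1) *
            (κ * η ^ (1 + κ * δ) / (1 + κ * δ) - η ^ (κ * δ) / (δ * (1 - p))) -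
          (α ^ (1 - p * (1 + κ * δ)) - 1) / (δ * (1 + κ * δ)) := by
          rw [C6, C2]
          generalize κ * η ^ (1 + κ * δ) / (1 + κ * δ) - η ^ (κ * δ) / (δ * (1 - p)) = X
          generalize α ^ (1 - p * (1 + κ * δ)) = β
          field_simp
        rw [e]
        linarith
      rw [Real.rpow_one_add' hys0.le hm] at h6
      have h6' : C6 κ δ p α η = (ys ^ (κ * δ) / δ - κ * (ys * ys ^ (κ * δ)) / (1 + κ * δ)) /
          ((1 + κ * δ) * (p * (1 + κ * δ) - 1)) := by
        rw [← h6]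
        field_simp
      rw [h6', Real.rpow_neg hys0.le]
      field_simp
    have hC5 : C5 κ δ p α η * ys + κ / (1 + κ * δ) * (ys * Real.log ys) =
        ys / (1 + κ * δ) * (dualSlope κ δ p α η ys - κ / (1 + κ * δ) - κ / (1 - p) / ys) := by
      rw [dualSlope, threePiece, if_neg (by linarith), if_neg (by linarith)]
      field_simp
      ring
    have hU : Uhat κ δ p α η ys =
        C5 κ δ p α η * ys + κ / (1 + κ * δ) * (ys * Real.log ys) +
          C6 κ δ p α η * ys ^ (-(κ * δ)) + 1 / (δ * (1 - p)) := by
      rw [Uhat, if_neg (by linarith), if_neg (by linarith)]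
      ring
    rw [hU, hC5, hC6, hP]
    field_simp
    ring

end Solution

theorem stmt5 (μ σ δ p : ℝ) (κ : ℝ)
    (hμ : 0 < μ) (hσ : 0 < σ) (hδ : 0 < δ) (hκ : κ = 2 * σ ^ 2 / μ ^ 2)
    (hp1 : 1 / (1 + κ * δ) < p) (hp2 : p < 1)
    (α₁ α₂ : ℝ) (hα₁ : 0 < α₁) (h12 : α₁ < α₂) (hα₂ : α₂ < 1)
    (y₁ η₁ y₂ η₂ : ℝ)
    (hy₁ : y₁ ∈ Set.Ioo (0 : ℝ) 1) (hη₁ : 1 < η₁)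
    (hS₁ : SystemS κ δ p α₁ y₁ η₁)
    (hy₂ : y₂ ∈ Set.Ioo (0 : ℝ) 1) (hη₂ : 1 < η₂)
    (hS₂ : SystemS κ δ p α₂ y₂ η₂) :
    ∀ y : ℝ,
      y ∈ Set.Ioo y₁ (η₁ * α₁ ^ (-p)) ∩ Set.Ioo y₂ (η₂ * α₂ ^ (-p)) →
        Uhat κ δ p α₂ η₂ y ≤ Uhat κ δ p α₁ η₁ y := by
  intro y ⟨h₁, h₂⟩
  have hκ0 : 0 < κ := by
    rw [hκ]
    positivity
  have hm : 0 < 1 + κ * δ := by positivity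
  have hp : 0 < p := lt_trans (by positivity) hp1
  have hq : 0 < p * (1 + κ * δ) - 1 := by
    rw [div_lt_iff₀ hm] at hp1
    linarith
  exact (dualSolution_Uhat hp hp2 hκ0 hδ hq hα₁ (h12.trans hα₂) hη₁ hy₁ hS₁).comparison
    (dualSolution_Uhat hp hp2 hκ0 hδ hq (hα₁.trans h12) hα₂ hη₂ hy₂ hS₂) h12 h₁ h₂

end
end

section
/- For every real a > 0 and every x ∈ (0, 1), one has 1/(1+a) − x^a + (a/(1+a))·x^{1+a} > 0. -/
open Real Set

theorem stmt6 (a x : ℝ) (ha : 0 < a) (hx : x ∈ Set.Ioo (0 : ℝ) 1) :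
    0 < 1 / (1 + a) - x ^ a + a / (1 + a) * x ^ (1 + a) := by
  obtain ⟨hx0, hx1⟩ := hx
  have hinv : 1 < x⁻¹ := (one_lt_inv₀ hx0).2 hx1
  -- Bernoulli's inequality at `x⁻¹ = 1 + (x⁻¹ - 1)` with exponent `1 + a`.
  have bernoulli := one_add_mul_self_lt_rpow_one_add (s := x⁻¹ - 1) (p := 1 + a)
    (by linarith) (by linarith) (by linarith)
  have hpow : x ^ (1 + a) = x * x ^ a := by rw [rpow_add hx0, rpow_one]
  rw [add_sub_cancel, inv_rpow hx0.le, hpow] at bernoulli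
  have hxa : 0 < x ^ a := rpow_pos_of_pos hx0 a
  have key : (1 + a) * x ^ a - a * (x * x ^ a) < 1 := by
    have h := mul_lt_mul_of_pos_right bernoulli (mul_pos hx0 hxa)
    rw [inv_mul_cancel₀ (mul_pos hx0 hxa).ne'] at h
    have hexpand : (1 + (1 + a) * (x⁻¹ - 1)) * (x * x ^ a)
        = (1 + a) * x ^ a - a * (x * x ^ a) := by
      linear_combination (1 + a) * x ^ a * inv_mul_cancel₀ hx0.ne'
    rwa [hexpand] at h
  have hfactor : 1 / (1 + a) - x ^ a + a / (1 + a) * x ^ (1 + a)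
      = (1 - ((1 + a) * x ^ a - a * (x * x ^ a))) / (1 + a) := by
    rw [hpow]
    field_simp
    ring
  rw [hfactor]
  exact div_pos (by linarith) (by linarith)
end

section
/- For every real a > 0 and every x ∈ (0, 1), one has (1/x − a/(1+a))·(1 − x^{1+a}) + ln x > 0. -/
open Real Set

theorem stmt7 (a x : ℝ) (ha : 0 < a) (hx : x ∈ Set.Ioo (0 : ℝ) 1) :
    0 < (1 / x - a / (1 + a)) * (1 - x ^ (1 + a)) + Real.log x := by
  obtain ⟨hx0, hx1⟩ := hx
  have hb : 0 < 1 + a := by linarith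
  obtain ⟨s, hs⟩ : ∃ s, s = -Real.log x := ⟨_, rfl⟩
  have hs0 : 0 < s := by linarith [Real.log_neg hx0 hx1]
  have hlog : Real.log x = -s := by linarith
  have hinv : 1 / x = Real.exp s := by
    rw [hs, Real.exp_neg, Real.exp_log hx0, one_div]
  have hpow : x ^ (1 + a) = (Real.exp ((1 + a) * s))⁻¹ := by
    rw [Real.rpow_def_of_pos hx0, hlog, ← Real.exp_neg]
    ring_nf
  have hbs : 0 < (1 + a) * s := mul_pos hb hs0
  have hp : s + 1 / (1 + a) < 1 / x - a / (1 + a) := by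
    have hsum : 1 / (1 + a) + a / (1 + a) = 1 := by field_simp
    linarith [Real.add_one_lt_exp hs0.ne']
  have hq : (1 + a) * s / (1 + (1 + a) * s) ≤ 1 - x ^ (1 + a) := by
    have hle : (Real.exp ((1 + a) * s))⁻¹ ≤ (1 + (1 + a) * s)⁻¹ :=
      inv_anti₀ (by linarith) (by linarith [Real.add_one_le_exp ((1 + a) * s)])
    have heq : (1 + a) * s / (1 + (1 + a) * s) = 1 - (1 + (1 + a) * s)⁻¹ := by
      field_simp
      ring
    rw [heq, hpow]
    linarith
  have hprod : (s + 1 / (1 + a)) * ((1 + a) * s / (1 + (1 + a) * s)) = s := by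
    field_simp
    ring
  have hlt : (s + 1 / (1 + a)) * ((1 + a) * s / (1 + (1 + a) * s)) <
      (1 / x - a / (1 + a)) * (1 - x ^ (1 + a)) :=
    mul_lt_mul hp hq (by positivity) (le_trans (by positivity) hp.le)
  linarith
end

section
/- For every real a > 0, every t ∈ (0, 1), and every x ∈ [t, 1], one has (1/t − a/(1+a))·(1 − x^{1+a}) + ln x ≥ 0. -/
open Real Set

theorem stmt8 (a t x : ℝ) (ha : 0 < a) (ht : t ∈ Set.Ioo (0 : ℝ) 1)
    (hx : x ∈ Set.Icc t 1) :
    0 ≤ (1 / t - a / (1 + a)) * (1 - x ^ (1 + a)) + Real.log x := by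
  obtain ⟨ht0, -⟩ := ht
  obtain ⟨htx, hx1⟩ := hx
  have hx0 : 0 < x := ht0.trans_le htx
  have hu0 : 0 < x ^ (1 + a) := rpow_pos_of_pos hx0 _
  have hu1 : x ^ (1 + a) ≤ 1 := rpow_le_one hx0.le hx1 (by linarith)
  have hlog : 1 - x⁻¹ ≤ Real.log x := one_sub_inv_le_log_of_pos hx0
  have hinv : x⁻¹ ≤ t⁻¹ := inv_anti₀ ht0 htx
  have hbern : 1 + (1 + a) * (x⁻¹ - 1) ≤ (x ^ (1 + a))⁻¹ := by
    have h := one_add_mul_self_le_rpow_one_add (s := x⁻¹ - 1) (p := 1 + a)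
      (by linarith [inv_pos.2 hx0]) (by linarith)
    rwa [add_sub_cancel, inv_rpow hx0.le] at h
  have hcoef : a / (1 + a) = 1 - (1 + a)⁻¹ := by field_simp; ring
  rw [one_div, hcoef]
  generalize x ^ (1 + a) = u at *
  have hmul : u * (x⁻¹ - 1) ≤ (1 + a)⁻¹ * (1 - u) := by
    rw [inv_mul_eq_div, le_div_iff₀ (by linarith)]
    have h := mul_le_mul_of_nonneg_left hbern hu0.le
    rw [mul_inv_cancel₀ hu0.ne'] at h
    linarith
  have hmono : x⁻¹ * (1 - u) ≤ t⁻¹ * (1 - u) :=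
    mul_le_mul_of_nonneg_right hinv (by linarith)
  linarith
end

section
/- For every real a > 0, every α ∈ (0, 1], and every η ≥ 1, one has η^{−(1+a)}/(a(1+a)) + 1/(1+a) + 1 − 1/α − (1+a)/(aη) − ln η < 0. -/
open Real Set

theorem stmt10 (a α η : ℝ) (ha : 0 < a) (hα : α ∈ Set.Ioc (0 : ℝ) 1)
    (hη : 1 ≤ η) :
    η ^ (-(1 + a)) / (a * (1 + a)) + 1 / (1 + a) + 1 - 1 / α -
        (1 + a) / (a * η) - Real.log η < 0 := by
  have hη0 : 0 < η := by linarith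
  have hα1 : 1 ≤ 1 / α := one_le_one_div hα.1 hα.2
  have hpow : η ^ (-(1 + a)) ≤ η⁻¹ := by
    rw [← Real.rpow_neg_one]
    exact Real.rpow_le_rpow_of_exponent_le hη (by linarith)
  have hlog : 1 - η⁻¹ ≤ Real.log η := Real.one_sub_inv_le_log_of_pos hη0
  have hdiv : η ^ (-(1 + a)) / (a * (1 + a)) ≤ η⁻¹ / (a * (1 + a)) := by
    gcongr
  have hsum : η⁻¹ / (a * (1 + a)) + 1 / (1 + a) - (1 + a) / (a * η) - (1 - η⁻¹)
      = -((η⁻¹ + a) / (1 + a)) := by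
    field_simp
    ring
  have hpos : 0 < (η⁻¹ + a) / (1 + a) := by positivity
  linarith
end

section
/- For every real a > 0, every t ∈ (0, 1), and every y ≥ 1, one has (1/t + ln t − 1) + (1/(1+a) − t^a + (a/(1+a))·t^{1+a})·y^{−(1+a)} > 0. -/
open Real Set

/-- Weighted AM-GM for `1` and `t ^ (1 + a)` with weights `1 / (1 + a)` and `a / (1 + a)`. -/
lemma rpow_le_weighted_mean {a t : ℝ} (ha : 0 < a) (ht : 0 ≤ t) :
    t ^ a ≤ 1 / (1 + a) + a / (1 + a) * t ^ (1 + a) := by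
  have h := Real.geom_mean_le_arith_mean2_weighted (w₁ := 1 / (1 + a)) (w₂ := a / (1 + a))
    (p₁ := 1) (p₂ := t ^ (1 + a)) (by positivity) (by positivity) zero_le_one (by positivity)
    (by field_simp)
  rwa [Real.one_rpow, one_mul, mul_one, ← Real.rpow_mul ht,
    mul_div_cancel₀ a (by positivity : 1 + a ≠ 0)] at h

theorem stmt11 (a t y : ℝ) (ha : 0 < a) (ht : t ∈ Set.Ioo (0 : ℝ) 1)
    (hy : 1 ≤ y) :
    0 < (1 / t + Real.log t - 1) +
        (1 / (1 + a) - t ^ a + a / (1 + a) * t ^ (1 + a)) * y ^ (-(1 + a)) := by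
  obtain ⟨ht0, ht1⟩ := ht
  have hlog : Real.log t⁻¹ < t⁻¹ - 1 :=
    Real.log_lt_sub_one_of_pos (inv_pos.2 ht0) (by simpa using ht1.ne)
  rw [Real.log_inv] at hlog
  have hmean := rpow_le_weighted_mean ha ht0.le
  refine add_pos_of_pos_of_nonneg ?_ (mul_nonneg ?_ ?_)
  · rw [one_div]
    linarith
  · linarith
  · positivity
end

section
/- For all reals a > 0 and p ∈ (0, 1) with p(1+a) > 1, every t ∈ (0, 1), and every y > 1, one has (y^{−1/p} − y^{−(1+a)}) + ((1+a)/t − a)·(t/y)^{1+a} > 0. -/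
open Real Set

theorem stmt12 (a p t y : ℝ) (ha : 0 < a) (hp : p ∈ Set.Ioo (0 : ℝ) 1)
    (hpa : 1 < p * (1 + a)) (ht : t ∈ Set.Ioo (0 : ℝ) 1) (hy : 1 < y) :
    0 < (y ^ (-(1 / p)) - y ^ (-(1 + a))) + ((1 + a) / t - a) * (t / y) ^ (1 + a) := by
  obtain ⟨hp0, -⟩ := hp
  obtain ⟨ht0, ht1⟩ := ht
  have hexp : 1 / p < 1 + a := by
    rw [div_lt_iff₀ hp0]
    linarith
  have hpow : y ^ (-(1 + a)) < y ^ (-(1 / p)) :=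
    Real.rpow_lt_rpow_of_exponent_lt hy (neg_lt_neg hexp)
  have hcoef : 0 < (1 + a) / t - a := by
    rw [sub_pos, lt_div_iff₀ ht0]
    nlinarith
  have hbase : 0 < t / y := div_pos ht0 (by linarith)
  exact add_pos (sub_pos.mpr hpow) (mul_pos hcoef (Real.rpow_pos_of_pos hbase _))
end

section
/- For every y ∈ [y*, y₀], one has (1−p)·Û(y) + p·y·Û′(y) ≤ 0, with equality at y = y* and at y = y₀. -/
open Real Set

noncomputable section

/-- The affine-logarithmic-power function `A y + B y^(-k) + c y log y + d`. -/
def logPiece (k A B c d y : ℝ) : ℝ :=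
  A * y + B * y ^ (-k) + c * (y * Real.log y) + d

theorem hasDerivAt_rpow_div (r : ℝ) {y : ℝ} (hy : 0 < y) :
    HasDerivAt (fun x : ℝ => x ^ r) (r * y ^ r / y) y := by
  have h := Real.hasDerivAt_rpow_const (x := y) (p := r) (Or.inl hy.ne')
  rwa [Real.rpow_sub_one hy.ne', ← mul_div_assoc] at h

theorem hasDerivAt_logPiece (k A B c d : ℝ) {y : ℝ} (hy : 0 < y) :
    HasDerivAt (logPiece k A B c d)
      ((A * y - k * B * y ^ (-k) + c * (y * Real.log y + y)) / y) y := by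
  have h := ((((hasDerivAt_id y).const_mul A).add ((hasDerivAt_rpow_div (-k) hy).const_mul B)).add
    (((hasDerivAt_id y).mul (Real.hasDerivAt_log hy.ne')).const_mul c)).add_const d
  refine h.congr_deriv ?_
  simp only [id]
  field_simp
  ring

theorem hasDerivAt_of_glue {F f g : ℝ → ℝ} {c d : ℝ} (hf : HasDerivAt f d c)
    (hg : HasDerivAt g d c) (hFf : ∀ᶠ y in nhds c, c ≤ y → F y = f y)
    (hFg : ∀ᶠ y in nhds c, y ≤ c → F y = g y) : HasDerivAt F d c := by
  rw [← hasDerivWithinAt_univ, ← Set.Iic_union_Ici (a := c)]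
  refine HasDerivWithinAt.union ?_ ?_
  · exact hg.hasDerivWithinAt.congr_of_eventuallyEq
      (eventually_nhdsWithin_iff.2 hFg) (hFg.self_of_nhds le_rfl)
  · exact hf.hasDerivWithinAt.congr_of_eventuallyEq
      (eventually_nhdsWithin_iff.2 hFf) (hFf.self_of_nhds le_rfl)

theorem antitoneOn_Icc_of_hasDerivAt_nonpos {f f' : ℝ → ℝ} {a b : ℝ}
    (hf : ∀ x ∈ Icc a b, HasDerivAt f (f' x) x) (h : ∀ x ∈ Icc a b, f' x ≤ 0) :
    AntitoneOn f (Icc a b) := by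
  refine antitoneOn_of_deriv_nonpos (convex_Icc a b)
    (fun x hx => (hf x hx).continuousAt.continuousWithinAt)
    (fun x hx => (hf x (interior_subset hx)).differentiableAt.differentiableWithinAt)
    (fun x hx => ?_)
  rw [(hf x (interior_subset hx)).deriv]
  exact h x (interior_subset hx)

theorem monotoneOn_Icc_of_hasDerivAt_nonneg {f f' : ℝ → ℝ} {a b : ℝ}
    (hf : ∀ x ∈ Icc a b, HasDerivAt f (f' x) x) (h : ∀ x ∈ Icc a b, 0 ≤ f' x) :
    MonotoneOn f (Icc a b) := by
  refine monotoneOn_of_deriv_nonneg (convex_Icc a b)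
    (fun x hx => (hf x hx).continuousAt.continuousWithinAt)
    (fun x hx => (hf x (interior_subset hx)).differentiableAt.differentiableWithinAt)
    (fun x hx => ?_)
  rw [(hf x (interior_subset hx)).deriv]
  exact h x (interior_subset hx)

/-- A function whose derivative changes sign at most once, from negative to positive, is
bounded by its values at the endpoints. -/
theorem nonpos_of_hasDerivAt_mul_monotone {f r K : ℝ → ℝ} {a b : ℝ}
    (hf : ∀ x ∈ Icc a b, HasDerivAt f (r x * K x) x) (hr : ∀ x ∈ Icc a b, 0 ≤ r x)
    (hK : MonotoneOn K (Icc a b)) (ha : f a ≤ 0) (hb : f b ≤ 0) {x : ℝ} (hx : x ∈ Icc a b) :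
    f x ≤ 0 := by
  rcases le_total (K x) 0 with h | h
  · have hsub : Icc a x ⊆ Icc a b := Icc_subset_Icc_right hx.2
    have := antitoneOn_Icc_of_hasDerivAt_nonpos (fun z hz => hf z (hsub hz))
      (fun z hz => mul_nonpos_of_nonneg_of_nonpos (hr z (hsub hz))
        ((hK (hsub hz) hx hz.2).trans h))
    exact (this (left_mem_Icc.2 hx.1) (right_mem_Icc.2 hx.1) hx.1).trans ha
  · have hsub : Icc x b ⊆ Icc a b := Icc_subset_Icc_left hx.1
    have := monotoneOn_Icc_of_hasDerivAt_nonneg (fun z hz => hf z (hsub hz))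
      (fun z hz => mul_nonneg (hr z (hsub hz)) (h.trans (hK hx (hsub hz) hz.1)))
    exact (this (left_mem_Icc.2 hx.2) (right_mem_Icc.2 hx.2) hx.2).trans hb

/-- The derivative of `(A y + B y^(-k) + c (y log y + p y) + d) / y`. -/
theorem hasDerivAt_quotient (k A B c d p : ℝ) {y : ℝ} (hy : 0 < y) :
    HasDerivAt (fun x : ℝ => (A * x + B * x ^ (-k) + c * (x * Real.log x + p * x) + d) / x)
      (y ^ (-k - 2) * (-(1 + k) * B + c * y ^ (1 + k) - d * y ^ k)) y := by
  have h := (((((hasDerivAt_id y).const_mul A).add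
    ((hasDerivAt_rpow_div (-k) hy).const_mul B)).add
    ((((hasDerivAt_id y).mul (Real.hasDerivAt_log hy.ne')).add
      ((hasDerivAt_id y).const_mul p)).const_mul c)).add_const d).div (hasDerivAt_id y) hy.ne'
  refine h.congr_deriv ?_
  have hk : y ^ k ≠ 0 := (Real.rpow_pos_of_pos hy k).ne'
  have e1 : y ^ (-k - 2) = (y ^ k)⁻¹ / y ^ 2 := by
    rw [Real.rpow_sub hy, Real.rpow_neg hy.le]; norm_num
  have e2 : y ^ (1 + k) = y * y ^ k := by rw [Real.rpow_add hy, Real.rpow_one]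
  simp only [id, Pi.add_apply, Pi.mul_apply, e1, e2, Real.rpow_neg hy.le]
  field_simp
  ring

/-- The derivative of `b + c y^(1+k) - d y^k`. -/
theorem hasDerivAt_rpow_combination (k b c d : ℝ) {y : ℝ} (hy : 0 < y) :
    HasDerivAt (fun x : ℝ => b + c * x ^ (1 + k) - d * x ^ k)
      (y ^ k / y * (c * (1 + k) * y - k * d)) y := by
  have h := (((hasDerivAt_rpow_div (1 + k) hy).const_mul c).const_add b).sub
    ((hasDerivAt_rpow_div k hy).const_mul d)
  refine h.congr_deriv ?_
  rw [Real.rpow_add hy, Real.rpow_one]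
  field_simp

/-- The function `A y + B y^(-k) + e y^q`. -/
def powPiece (k q A B e y : ℝ) : ℝ :=
  A * y + B * y ^ (-k) + e * y ^ q

theorem hasDerivAt_powPiece (k q A B e : ℝ) {y : ℝ} (hy : 0 < y) :
    HasDerivAt (powPiece k q A B e)
      ((A * y - k * B * y ^ (-k) + e * q * y ^ q) / y) y := by
  have h := (((hasDerivAt_id y).const_mul A).add ((hasDerivAt_rpow_div (-k) hy).const_mul B)).add
    ((hasDerivAt_rpow_div q hy).const_mul e)
  refine h.congr_deriv ?_
  field_simp
  ring

/-- The branch of `Uhat` on `[α^(-p), ∞)`. -/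
def upperPiece (κ δ p α η : ℝ) : ℝ → ℝ :=
  logPiece (κ * δ) (C1 κ δ p α η) (C2 κ δ p α η) (κ * α / (1 + κ * δ))
    (α ^ (1 - p) / (δ * (1 - p)))

/-- The branch of `Uhat` on `(1, α^(-p))`. -/
def middlePiece (κ δ p α η : ℝ) : ℝ → ℝ :=
  powPiece (κ * δ) (-(1 - p) / p) (C3 κ δ p α η) (C4 κ δ p α η)
    (κ * p ^ 3 / ((1 - p) * (p * (1 + κ * δ) - 1)))

/-- The branch of `Uhat` on `(0, 1]`. -/
def lowerPiece (κ δ p α η : ℝ) : ℝ → ℝ :=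
  logPiece (κ * δ) (C5 κ δ p α η) (C6 κ δ p α η) (κ / (1 + κ * δ)) (1 / (δ * (1 - p)))

section Gluing

variable {κ δ p α η : ℝ}

theorem lowerPiece_one (hκ : 0 < κ) (hδ : 0 < δ) (hp2 : p < 1) (hm : 0 < p * (1 + κ * δ) - 1) :
    lowerPiece κ δ p α η 1 = middlePiece κ δ p α η 1 := by
  have hp' : 1 - p ≠ 0 := (sub_pos.2 hp2).ne'
  have hβ : 1 + κ * δ ≠ 0 := by positivity
  have hm' := hm.ne'
  simp only [lowerPiece, middlePiece, logPiece, powPiece, Real.one_rpow, Real.log_one, C3, C4, C5,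
    C6, C2, div_mul_eq_div_div α η (1 - p), div_mul_eq_div_div 1 η (1 - p)]
  generalize α ^ (1 - p * (1 + κ * δ)) = E
  generalize κ * η ^ (1 + κ * δ) / (1 + κ * δ) - η ^ (κ * δ) / (δ * (1 - p)) = Z
  generalize Real.log η = L
  rw [div_eq_mul_inv α η, div_eq_mul_inv 1 η]
  generalize η⁻¹ = H
  clear hm
  generalize hmdef : p * (1 + κ * δ) - 1 = m at hm' ⊢
  field_simp
  subst hmdef
  ring

theorem hasDerivAt_lowerPiece_one (hκ : 0 < κ) (hδ : 0 < δ) (hp : 0 < p) (hp2 : p < 1)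
    (hm : 0 < p * (1 + κ * δ) - 1) :
    HasDerivAt (lowerPiece κ δ p α η) (deriv (middlePiece κ δ p α η) 1) 1 := by
  refine (hasDerivAt_logPiece _ _ _ _ _ one_pos).congr_deriv ?_
  rw [middlePiece, (hasDerivAt_powPiece _ _ _ _ _ one_pos).deriv]
  have hp' : 1 - p ≠ 0 := (sub_pos.2 hp2).ne'
  have hβ : 1 + κ * δ ≠ 0 := by positivity
  have hp0 := hp.ne'
  have hm' := hm.ne'
  simp only [Real.one_rpow, Real.log_one, C3, C4, C5,
    C6, C2, div_mul_eq_div_div α η (1 - p), div_mul_eq_div_div 1 η (1 - p)]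
  generalize α ^ (1 - p * (1 + κ * δ)) = E
  generalize κ * η ^ (1 + κ * δ) / (1 + κ * δ) - η ^ (κ * δ) / (δ * (1 - p)) = Z
  generalize Real.log η = L
  rw [div_eq_mul_inv α η, div_eq_mul_inv 1 η]
  generalize η⁻¹ = H
  clear hm
  generalize hmdef : p * (1 + κ * δ) - 1 = m at hm' ⊢
  field_simp
  subst hmdef
  ring

theorem rpow_threshold_mul (hα : 0 < α) :
    α ^ (1 - p * (1 + κ * δ)) * (α ^ (-p)) ^ (-(κ * δ)) = α ^ (1 - p) := by
  rw [← Real.rpow_mul hα.le, ← Real.rpow_add hα]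
  ring_nf

theorem mul_rpow_threshold (hα : 0 < α) : α * α ^ (-p) = α ^ (1 - p) := by
  rw [sub_eq_add_neg, Real.rpow_add hα, Real.rpow_one]

theorem threshold_rpow (hα : 0 < α) (hp : 0 < p) :
    (α ^ (-p)) ^ (-(1 - p) / p) = α ^ (1 - p) := by
  rw [← Real.rpow_mul hα.le]
  congr 1
  field_simp

theorem C1_mul_threshold (hα : 0 < α) :
    C1 κ δ p α η * α ^ (-p) = -(κ * α ^ (1 - p) / (1 + κ * δ)) *
      (Real.log η - p * Real.log α + 1 / (η * (1 - p)) + 1 / (1 + κ * δ)) := by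
  rw [← mul_rpow_threshold hα, C1]; ring

theorem C2_mul_threshold (hα : 0 < α) :
    C2 κ δ p α η * (α ^ (-p)) ^ (-(κ * δ)) = α ^ (1 - p) / (1 + κ * δ) *
      (κ * η ^ (1 + κ * δ) / (1 + κ * δ) - η ^ (κ * δ) / (δ * (1 - p))) := by
  rw [← rpow_threshold_mul (κ := κ) (δ := δ) (p := p) hα, C2]; ring

theorem C3_mul_threshold (hα : 0 < α) :
    C3 κ δ p α η * α ^ (-p) = -(κ * α ^ (1 - p) / (1 + κ * δ)) *
      (Real.log η + 1 / (η * (1 - p)) - (1 + p)) := by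
  rw [← mul_rpow_threshold hα, C3]; ring

theorem C4_mul_threshold (hα : 0 < α) :
    C4 κ δ p α η * (α ^ (-p)) ^ (-(κ * δ)) = α ^ (1 - p) / (1 + κ * δ) *
      (κ * η ^ (1 + κ * δ) / (1 + κ * δ) - η ^ (κ * δ) / (δ * (1 - p)) -
        1 / (δ * (1 + κ * δ) * (p * (1 + κ * δ) - 1))) := by
  rw [← rpow_threshold_mul (κ := κ) (δ := δ) (p := p) hα, C4]; ring

theorem upperPiece_threshold (hκ : 0 < κ) (hδ : 0 < δ) (hp : 0 < p) (hp2 : p < 1) (hα : 0 < α)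
    (hm : 0 < p * (1 + κ * δ) - 1) :
    upperPiece κ δ p α η (α ^ (-p)) = middlePiece κ δ p α η (α ^ (-p)) := by
  have hp' : 1 - p ≠ 0 := (sub_pos.2 hp2).ne'
  have hβ : 1 + κ * δ ≠ 0 := by positivity
  have hm' := hm.ne'
  have e : κ * α / (1 + κ * δ) * (α ^ (-p) * Real.log (α ^ (-p))) =
      κ * α ^ (1 - p) / (1 + κ * δ) * (-p * Real.log α) := by
    rw [Real.log_rpow hα, ← mul_rpow_threshold hα]; ring
  rw [upperPiece, middlePiece, logPiece, powPiece, e, C1_mul_threshold hα, C2_mul_threshold hα,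
    C3_mul_threshold hα, C4_mul_threshold hα, threshold_rpow hα hp]
  generalize κ * η ^ (1 + κ * δ) / (1 + κ * δ) - η ^ (κ * δ) / (δ * (1 - p)) = Z
  generalize 1 / (η * (1 - p)) = H
  field_simp
  ring

theorem hasDerivAt_upperPiece_threshold (hκ : 0 < κ) (hδ : 0 < δ) (hp : 0 < p) (hp2 : p < 1)
    (hα : 0 < α) (hm : 0 < p * (1 + κ * δ) - 1) :
    HasDerivAt (upperPiece κ δ p α η) (deriv (middlePiece κ δ p α η) (α ^ (-p))) (α ^ (-p)) := by
  have ha : 0 < α ^ (-p) := Real.rpow_pos_of_pos hα _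
  refine (hasDerivAt_logPiece _ _ _ _ _ ha).congr_deriv ?_
  rw [middlePiece, (hasDerivAt_powPiece _ _ _ _ _ ha).deriv]
  congr 1
  have hp' : 1 - p ≠ 0 := (sub_pos.2 hp2).ne'
  have hβ : 1 + κ * δ ≠ 0 := by positivity
  have hm' := hm.ne'
  have e : κ * α / (1 + κ * δ) * (α ^ (-p) * Real.log (α ^ (-p)) + α ^ (-p)) =
      κ * α ^ (1 - p) / (1 + κ * δ) * (-p * Real.log α + 1) := by
    rw [Real.log_rpow hα, ← mul_rpow_threshold hα]; ring
  rw [e, C1_mul_threshold hα, mul_assoc (κ * δ), C2_mul_threshold hα,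
    C3_mul_threshold hα, mul_assoc (κ * δ), C4_mul_threshold hα, threshold_rpow hα hp]
  generalize κ * η ^ (1 + κ * δ) / (1 + κ * δ) - η ^ (κ * δ) / (δ * (1 - p)) = Z
  generalize 1 / (η * (1 - p)) = H
  field_simp
  ring

theorem Uhat_of_threshold_le {y : ℝ} (h : α ^ (-p) ≤ y) :
    Uhat κ δ p α η y = upperPiece κ δ p α η y := by
  rw [Uhat, if_pos h]; rfl

theorem Uhat_of_mem_Ioo {y : ℝ} (h : y ∈ Ioo 1 (α ^ (-p))) :
    Uhat κ δ p α η y = middlePiece κ δ p α η y := by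
  rw [Uhat, if_neg h.2.not_ge, if_pos h.1]; rfl

theorem one_lt_threshold (hα : 0 < α) (hα1 : α < 1) (hp : 0 < p) : 1 < α ^ (-p) :=
  Real.one_lt_rpow_of_pos_of_lt_one_of_neg hα hα1 (neg_neg_of_pos hp)

theorem Uhat_of_le_one (hα : 0 < α) (hα1 : α < 1) (hp : 0 < p) {y : ℝ} (h : y ≤ 1) :
    Uhat κ δ p α η y = lowerPiece κ δ p α η y := by
  have := one_lt_threshold hα hα1 hp
  rw [Uhat, if_neg (by linarith), if_neg h.not_gt]; rfl

theorem Uhat_of_mem_Icc (hκ : 0 < κ) (hδ : 0 < δ) (hp : 0 < p) (hp2 : p < 1) (hα : 0 < α)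
    (hα1 : α < 1) (hm : 0 < p * (1 + κ * δ) - 1) {y : ℝ} (h : y ∈ Icc 1 (α ^ (-p))) :
    Uhat κ δ p α η y = middlePiece κ δ p α η y := by
  rcases h.1.eq_or_lt with rfl | h1
  · rw [Uhat_of_le_one hα hα1 hp le_rfl, lowerPiece_one hκ hδ hp2 hm]
  rcases h.2.eq_or_lt with rfl | h2
  · rw [Uhat_of_threshold_le le_rfl, upperPiece_threshold hκ hδ hp hp2 hα hm]
  exact Uhat_of_mem_Ioo ⟨h1, h2⟩

theorem hasDerivAt_Uhat_threshold (hκ : 0 < κ) (hδ : 0 < δ) (hp : 0 < p) (hp2 : p < 1)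
    (hα : 0 < α) (hα1 : α < 1) (hm : 0 < p * (1 + κ * δ) - 1) :
    HasDerivAt (Uhat κ δ p α η) (deriv (middlePiece κ δ p α η) (α ^ (-p))) (α ^ (-p)) := by
  have h1 := one_lt_threshold hα hα1 hp
  refine hasDerivAt_of_glue (hasDerivAt_upperPiece_threshold hκ hδ hp hp2 hα hm)
    (hasDerivAt_powPiece _ _ _ _ _ (one_pos.trans h1)).differentiableAt.hasDerivAt
    (.of_forall fun y hy => Uhat_of_threshold_le hy) ?_
  filter_upwards [lt_mem_nhds h1] with y hy hya
  exact Uhat_of_mem_Icc hκ hδ hp hp2 hα hα1 hm ⟨hy.le, hya⟩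

theorem hasDerivAt_Uhat_one (hκ : 0 < κ) (hδ : 0 < δ) (hp : 0 < p) (hp2 : p < 1)
    (hα : 0 < α) (hα1 : α < 1) (hm : 0 < p * (1 + κ * δ) - 1) :
    HasDerivAt (Uhat κ δ p α η) (deriv (middlePiece κ δ p α η) 1) 1 := by
  have h1 := one_lt_threshold hα hα1 hp
  refine hasDerivAt_of_glue
    (hasDerivAt_powPiece _ _ _ _ _ one_pos).differentiableAt.hasDerivAt
    (hasDerivAt_lowerPiece_one hκ hδ hp hp2 hm) ?_
    (.of_forall fun y hy => Uhat_of_le_one hα hα1 hp hy)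
  filter_upwards [gt_mem_nhds h1] with y hy hya
  exact Uhat_of_mem_Icc hκ hδ hp hp2 hα hα1 hm ⟨hya, hy.le⟩

theorem deriv_Uhat_of_threshold_le (hκ : 0 < κ) (hδ : 0 < δ) (hp : 0 < p) (hp2 : p < 1)
    (hα : 0 < α) (hα1 : α < 1) (hm : 0 < p * (1 + κ * δ) - 1) {y : ℝ} (h : α ^ (-p) ≤ y) :
    deriv (Uhat κ δ p α η) y = deriv (upperPiece κ δ p α η) y := by
  rcases h.eq_or_lt with rfl | h
  · rw [(hasDerivAt_Uhat_threshold hκ hδ hp hp2 hα hα1 hm).deriv,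
      (hasDerivAt_upperPiece_threshold hκ hδ hp hp2 hα hm).deriv]
  · refine Filter.EventuallyEq.deriv_eq ?_
    filter_upwards [lt_mem_nhds h] with z hz using Uhat_of_threshold_le hz.le

theorem deriv_Uhat_of_mem_Icc (hκ : 0 < κ) (hδ : 0 < δ) (hp : 0 < p) (hp2 : p < 1)
    (hα : 0 < α) (hα1 : α < 1) (hm : 0 < p * (1 + κ * δ) - 1) {y : ℝ}
    (h : y ∈ Icc 1 (α ^ (-p))) :
    deriv (Uhat κ δ p α η) y = deriv (middlePiece κ δ p α η) y := by
  rcases h.1.eq_or_lt with rfl | h1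
  · exact (hasDerivAt_Uhat_one hκ hδ hp hp2 hα hα1 hm).deriv
  rcases h.2.eq_or_lt with rfl | h2
  · exact (hasDerivAt_Uhat_threshold hκ hδ hp hp2 hα hα1 hm).deriv
  refine Filter.EventuallyEq.deriv_eq ?_
  filter_upwards [lt_mem_nhds h1, gt_mem_nhds h2] with z hz hz' using Uhat_of_mem_Ioo ⟨hz, hz'⟩

theorem deriv_Uhat_of_le_one (hκ : 0 < κ) (hδ : 0 < δ) (hp : 0 < p) (hp2 : p < 1)
    (hα : 0 < α) (hα1 : α < 1) (hm : 0 < p * (1 + κ * δ) - 1) {y : ℝ} (h : y ≤ 1) :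
    deriv (Uhat κ δ p α η) y = deriv (lowerPiece κ δ p α η) y := by
  rcases h.eq_or_lt with rfl | h
  · rw [(hasDerivAt_Uhat_one hκ hδ hp hp2 hα hα1 hm).deriv,
      (hasDerivAt_lowerPiece_one hκ hδ hp hp2 hm).deriv]
  · refine Filter.EventuallyEq.deriv_eq ?_
    filter_upwards [gt_mem_nhds h] with z hz using Uhat_of_le_one hα hα1 hp hz.le

end Gluing

/-- The operator `f ↦ (1 - p) f + p y f'` applied to a logarithmic piece, divided by `y`. -/
def logQuotient (k p A B c d y : ℝ) : ℝ :=
  (A * y + -(p * (1 + k) - 1) * B * y ^ (-k) + c * (y * Real.log y + p * y) + (1 - p) * d) / y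

theorem operator_logPiece (k p A B c d : ℝ) {y : ℝ} (hy : 0 < y) :
    (1 - p) * logPiece k A B c d y + p * y * deriv (logPiece k A B c d) y =
      y * logQuotient k p A B c d y := by
  rw [(hasDerivAt_logPiece k A B c d hy).deriv, logPiece, logQuotient]
  field_simp
  ring

theorem operator_powPiece (k p A B e : ℝ) (hp : p ≠ 0) {y : ℝ} (hy : 0 < y) :
    (1 - p) * powPiece k (-(1 - p) / p) A B e y +
        p * y * deriv (powPiece k (-(1 - p) / p) A B e) y =
      y * logQuotient k p A B 0 0 y := by
  rw [(hasDerivAt_powPiece k _ A B e hy).deriv, powPiece, logQuotient]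
  generalize y ^ (-(1 - p) / p) = Y
  field_simp
  ring

/-- The factor of the derivative of `logQuotient` that carries its sign. -/
def logSlope (k p B c d y : ℝ) : ℝ :=
  -(1 + k) * (-(p * (1 + k) - 1) * B) + c * y ^ (1 + k) - (1 - p) * d * y ^ k

theorem hasDerivAt_logQuotient (k p A B c d : ℝ) {y : ℝ} (hy : 0 < y) :
    HasDerivAt (logQuotient k p A B c d) (y ^ (-k - 2) * logSlope k p B c d y) y :=
  hasDerivAt_quotient k A (-(p * (1 + k) - 1) * B) c ((1 - p) * d) p hy

theorem antitoneOn_logQuotient {k p A B c d a b : ℝ} (ha : 0 < a)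
    (h : ∀ x ∈ Icc a b, logSlope k p B c d x ≤ 0) :
    AntitoneOn (logQuotient k p A B c d) (Icc a b) :=
  antitoneOn_Icc_of_hasDerivAt_nonpos
    (fun _ hx => hasDerivAt_logQuotient k p A B c d (ha.trans_le hx.1))
    (fun x hx => mul_nonpos_of_nonneg_of_nonpos
      (Real.rpow_nonneg (ha.le.trans hx.1) _) (h x hx))

theorem antitoneOn_logSlope {k p B c d a b : ℝ} (ha : 0 < a)
    (h : ∀ x ∈ Icc a b, c * (1 + k) * x ≤ k * ((1 - p) * d)) :
    AntitoneOn (logSlope k p B c d) (Icc a b) :=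
  antitoneOn_Icc_of_hasDerivAt_nonpos
    (fun _ hx => hasDerivAt_rpow_combination k _ c _ (ha.trans_le hx.1))
    (fun x hx => mul_nonpos_of_nonneg_of_nonpos
      (div_nonneg (Real.rpow_nonneg (ha.le.trans hx.1) _) (ha.le.trans hx.1))
      (sub_nonpos.2 (h x hx)))

theorem monotoneOn_logSlope {k p B c d a b : ℝ} (ha : 0 < a)
    (h : ∀ x ∈ Icc a b, k * ((1 - p) * d) ≤ c * (1 + k) * x) :
    MonotoneOn (logSlope k p B c d) (Icc a b) :=
  monotoneOn_Icc_of_hasDerivAt_nonneg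
    (fun _ hx => hasDerivAt_rpow_combination k _ c _ (ha.trans_le hx.1))
    (fun x hx => mul_nonneg
      (div_nonneg (Real.rpow_nonneg (ha.le.trans hx.1) _) (ha.le.trans hx.1))
      (sub_nonneg.2 (h x hx)))

section Boundary

variable {κ δ p α y η : ℝ}

/-- The second equation of the system says that the slope of the lower quotient vanishes at `y`. -/
theorem logSlope_lower_eq_zero (hκ : 0 < κ) (hδ : 0 < δ) (hp2 : p < 1)
    (hm : 0 < p * (1 + κ * δ) - 1) (hS : SystemS κ δ p α y η) :
    logSlope (κ * δ) p (C6 κ δ p α η) (κ / (1 + κ * δ)) (1 / (δ * (1 - p))) y = 0 := by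
  have hp' : 1 - p ≠ 0 := (sub_pos.2 hp2).ne'
  have hβ : 1 + κ * δ ≠ 0 := by positivity
  have hm' := hm.ne'
  have h := hS.2
  have e : (1 + κ * δ) * ((p * (1 + κ * δ) - 1) * C6 κ δ p α η) =
      α ^ (1 - p * (1 + κ * δ)) * (p * (1 + κ * δ) - 1) *
      (κ * η ^ (1 + κ * δ) / (1 + κ * δ) - η ^ (κ * δ) / (δ * (1 - p))) -
      (α ^ (1 - p * (1 + κ * δ)) - 1) / (δ * (1 + κ * δ)) := by
    rw [C6, C2]
    generalize κ * η ^ (1 + κ * δ) / (1 + κ * δ) - η ^ (κ * δ) / (δ * (1 - p)) = Z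
    generalize α ^ (1 - p * (1 + κ * δ)) = E
    clear hm
    generalize p * (1 + κ * δ) - 1 = m at hm' ⊢
    field_simp
  have e2 : (1 - p) * (1 / (δ * (1 - p))) = 1 / δ := by field_simp
  rw [logSlope, e2]
  linear_combination e + h

/-- At `y` the lower quotient vanishes, by both equations of the system. -/
theorem logQuotient_lower_eq_zero (hκ : 0 < κ) (hδ : 0 < δ) (hp2 : p < 1)
    (hm : 0 < p * (1 + κ * δ) - 1) (hy : 0 < y) (hS : SystemS κ δ p α y η) :
    logQuotient (κ * δ) p (C5 κ δ p α η) (C6 κ δ p α η) (κ / (1 + κ * δ))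
      (1 / (δ * (1 - p))) y = 0 := by
  have hp' : 1 - p ≠ 0 := (sub_pos.2 hp2).ne'
  have hβ : 1 + κ * δ ≠ 0 := by positivity
  have hs := logSlope_lower_eq_zero hκ hδ hp2 hm hS
  have e2 : (1 - p) * (1 / (δ * (1 - p))) = 1 / δ := by field_simp
  have hk : y ^ (κ * δ) ≠ 0 := (Real.rpow_pos_of_pos hy _).ne'
  rw [logSlope, e2, Real.rpow_add hy, Real.rpow_one] at hs
  have h5 : C5 κ δ p α η =
      -(κ / (1 + κ * δ)) * (Real.log y + 1 / y + p + 1 / (1 + κ * δ)) := by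
    rw [C5]
    linear_combination -(κ / (1 + κ * δ)) * hS.1
  have h6 : -(p * (1 + κ * δ) - 1) * C6 κ δ p α η * y ^ (-(κ * δ)) =
      (κ / (1 + κ * δ) * y - 1 / δ) / (1 + κ * δ) := by
    rw [Real.rpow_neg hy.le, ← div_eq_mul_inv, div_eq_div_iff hk hβ]
    linear_combination -hs
  rw [logQuotient, h6, h5, e2]
  field_simp
  ring

theorem logQuotient_upper_eq_zero (hκ : 0 < κ) (hδ : 0 < δ) (hp2 : p < 1) (hα : 0 < α)
    (hη : 0 < η) :
    logQuotient (κ * δ) p (C1 κ δ p α η) (C2 κ δ p α η) (κ * α / (1 + κ * δ))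
      (α ^ (1 - p) / (δ * (1 - p))) (η * α ^ (-p)) = 0 := by
  have hp' : 1 - p ≠ 0 := (sub_pos.2 hp2).ne'
  have hβ : 1 + κ * δ ≠ 0 := by positivity
  have ha : 0 < α ^ (-p) := Real.rpow_pos_of_pos hα _
  have hk : η ^ (κ * δ) ≠ 0 := (Real.rpow_pos_of_pos hη _).ne'
  have h1 : C1 κ δ p α η * (η * α ^ (-p)) = -(κ * α ^ (1 - p) / (1 + κ * δ)) *
      (Real.log η - p * Real.log α + 1 / (η * (1 - p)) + 1 / (1 + κ * δ)) * η := by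
    rw [← C1_mul_threshold hα]; ring
  have h2 : -(p * (1 + κ * δ) - 1) * C2 κ δ p α η * (η * α ^ (-p)) ^ (-(κ * δ)) =
      -(p * (1 + κ * δ) - 1) * (α ^ (1 - p) / (1 + κ * δ) *
        (κ * η / (1 + κ * δ) - 1 / (δ * (1 - p)))) := by
    rw [Real.mul_rpow hη.le ha.le, mul_comm (η ^ _), mul_assoc, ← mul_assoc (C2 κ δ p α η),
      C2_mul_threshold hα, Real.rpow_neg hη.le, Real.rpow_add hη, Real.rpow_one]
    field_simp
  have h3 : κ * α / (1 + κ * δ) * (η * α ^ (-p) * Real.log (η * α ^ (-p)) + p * (η * α ^ (-p))) =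
      κ * α ^ (1 - p) / (1 + κ * δ) * (Real.log η - p * Real.log α + p) * η := by
    rw [Real.log_mul hη.ne' ha.ne', Real.log_rpow hα, ← mul_rpow_threshold hα]; ring
  rw [logQuotient, h1, h2, h3, div_eq_zero_iff]
  left
  field_simp
  ring

/-- The slope is continuous at `1`, and constant on the middle interval. -/
theorem logSlope_middle (hκ : 0 < κ) (hδ : 0 < δ) (hp2 : p < 1)
    (hm : 0 < p * (1 + κ * δ) - 1) (x : ℝ) :
    logSlope (κ * δ) p (C4 κ δ p α η) 0 0 x =
      logSlope (κ * δ) p (C6 κ δ p α η) (κ / (1 + κ * δ)) (1 / (δ * (1 - p))) 1 := by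
  have hp' : 1 - p ≠ 0 := (sub_pos.2 hp2).ne'
  have hβ : 1 + κ * δ ≠ 0 := by positivity
  have hm' := hm.ne'
  simp only [logSlope, Real.one_rpow, C4, C6, C2]
  generalize κ * η ^ (1 + κ * δ) / (1 + κ * δ) - η ^ (κ * δ) / (δ * (1 - p)) = Z
  generalize α ^ (1 - p * (1 + κ * δ)) = E
  clear hm
  generalize p * (1 + κ * δ) - 1 = m at hm' ⊢
  field_simp
  ring

end Boundary

theorem stmt13 (μ σ δ p α κ : ℝ)
    (hμ : 0 < μ) (hσ : 0 < σ) (hδ : 0 < δ) (hκ : κ = 2 * σ ^ 2 / μ ^ 2)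
    (hα : α ∈ Set.Ioo (0 : ℝ) 1) (hp1 : 1 / (1 + κ * δ) < p) (hp2 : p < 1) (ystar ηstar y0 : ℝ)
    (hy : ystar ∈ Set.Ioo (0 : ℝ) 1) (hη : 1 < ηstar)
    (hS : SystemS κ δ p α ystar ηstar) (hy0 : y0 = ηstar * α ^ (-p)) :
    (∀ y ∈ Set.Icc ystar y0,
      (1 - p) * Uhat κ δ p α ηstar y +
          p * y * deriv (Uhat κ δ p α ηstar) y ≤ 0) ∧
    (1 - p) * Uhat κ δ p α ηstar ystar +
        p * ystar * deriv (Uhat κ δ p α ηstar) ystar = 0 ∧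
    (1 - p) * Uhat κ δ p α ηstar y0 +
        p * y0 * deriv (Uhat κ δ p α ηstar) y0 = 0 := by
  obtain ⟨hα0, hα1⟩ := hα
  obtain ⟨hy0', hy1⟩ := hy
  have hκ0 : 0 < κ := by rw [hκ]; positivity
  clear hκ
  have hβ : 0 < 1 + κ * δ := by positivity
  have hp : 0 < p := (by positivity : 0 < 1 / (1 + κ * δ)).trans hp1
  have hm : 0 < p * (1 + κ * δ) - 1 := sub_pos.2 ((div_lt_iff₀ hβ).1 hp1)
  have hp' : 0 < 1 - p := sub_pos.2 hp2
  have ha1 := one_lt_threshold hα0 hα1 hp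
  have ha0 := one_pos.trans ha1
  have hay : α ^ (-p) ≤ y0 := by rw [hy0]; exact le_mul_of_one_le_left ha0.le hη.le
  set wA := logQuotient (κ * δ) p (C1 κ δ p α ηstar) (C2 κ δ p α ηstar) (κ * α / (1 + κ * δ))
      (α ^ (1 - p) / (δ * (1 - p)))
  set wB := logQuotient (κ * δ) p (C3 κ δ p α ηstar) (C4 κ δ p α ηstar) 0 0
  set wC := logQuotient (κ * δ) p (C5 κ δ p α ηstar) (C6 κ δ p α ηstar) (κ / (1 + κ * δ))
      (1 / (δ * (1 - p)))
  have hA : ∀ y, α ^ (-p) ≤ y → (1 - p) * Uhat κ δ p α ηstar y +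
      p * y * deriv (Uhat κ δ p α ηstar) y = y * wA y := fun y h => by
    rw [Uhat_of_threshold_le h, deriv_Uhat_of_threshold_le hκ0 hδ hp hp2 hα0 hα1 hm h]
    exact operator_logPiece _ _ _ _ _ _ (ha0.trans_le h)
  have hB : ∀ y ∈ Icc 1 (α ^ (-p)), (1 - p) * Uhat κ δ p α ηstar y +
      p * y * deriv (Uhat κ δ p α ηstar) y = y * wB y := fun y h => by
    rw [Uhat_of_mem_Icc hκ0 hδ hp hp2 hα0 hα1 hm h,
      deriv_Uhat_of_mem_Icc hκ0 hδ hp hp2 hα0 hα1 hm h]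
    exact operator_powPiece _ _ _ _ _ hp.ne' (one_pos.trans_le h.1)
  have hC : ∀ y, 0 < y → y ≤ 1 → (1 - p) * Uhat κ δ p α ηstar y +
      p * y * deriv (Uhat κ δ p α ηstar) y = y * wC y := fun y h h' => by
    rw [Uhat_of_le_one hα0 hα1 hp h', deriv_Uhat_of_le_one hκ0 hδ hp hp2 hα0 hα1 hm h']
    exact operator_logPiece _ _ _ _ _ _ h
  have hCstar : wC ystar = 0 := logQuotient_lower_eq_zero hκ0 hδ hp2 hm hy0' hS
  have hAy0 : wA y0 = 0 := by
    rw [hy0]; exact logQuotient_upper_eq_zero hκ0 hδ hp2 hα0 (one_pos.trans hη)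
  have hslopeC : ∀ x ∈ Icc ystar 1, logSlope (κ * δ) p (C6 κ δ p α ηstar) (κ / (1 + κ * δ))
      (1 / (δ * (1 - p))) x ≤ 0 := fun x hx => by
    rw [← logSlope_lower_eq_zero hκ0 hδ hp2 hm hS]
    refine antitoneOn_logSlope hy0' (fun z hz => ?_) (left_mem_Icc.2 hy1.le) hx hx.1
    have e1 : κ / (1 + κ * δ) * (1 + κ * δ) * z = κ * z := by field_simp
    have e2 : κ * δ * ((1 - p) * (1 / (δ * (1 - p)))) = κ := by field_simp
    rw [e1, e2]
    exact mul_le_of_le_one_right hκ0.le hz.2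
  have hCneg : ∀ x ∈ Icc ystar 1, wC x ≤ 0 := fun x hx =>
    (antitoneOn_logQuotient hy0' hslopeC (left_mem_Icc.2 hy1.le) hx hx.1).trans hCstar.le
  have hB1 : wB 1 ≤ 0 := by
    have h := (hB 1 (left_mem_Icc.2 ha1.le)).symm.trans (hC 1 one_pos le_rfl)
    rw [one_mul, one_mul] at h
    rw [h]; exact hCneg 1 (right_mem_Icc.2 hy1.le)
  have hBneg : ∀ x ∈ Icc 1 (α ^ (-p)), wB x ≤ 0 := fun x hx =>
    (antitoneOn_logQuotient one_pos (fun z _ => by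
      rw [logSlope_middle hκ0 hδ hp2 hm]
      exact hslopeC 1 (right_mem_Icc.2 hy1.le)) (left_mem_Icc.2 ha1.le) hx hx.1).trans hB1
  have hAa : wA (α ^ (-p)) ≤ 0 := by
    have h := (hA _ le_rfl).symm.trans (hB _ (right_mem_Icc.2 ha1.le))
    rw [mul_left_cancel₀ ha0.ne' h]
    exact hBneg _ (right_mem_Icc.2 ha1.le)
  have hAneg : ∀ x ∈ Icc (α ^ (-p)) y0, wA x ≤ 0 := fun x hx => by
    refine nonpos_of_hasDerivAt_mul_monotone
      (fun z hz => hasDerivAt_logQuotient _ _ _ _ _ _ (ha0.trans_le hz.1))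
      (fun z hz => Real.rpow_nonneg (ha0.le.trans hz.1) _)
      (monotoneOn_logSlope ha0 fun z hz => ?_) hAa hAy0.le hx
    have e1 : κ * α / (1 + κ * δ) * (1 + κ * δ) * z = κ * (α * z) := by field_simp
    have e2 : κ * δ * ((1 - p) * (α ^ (1 - p) / (δ * (1 - p)))) = κ * α ^ (1 - p) := by
      field_simp
    rw [e1, e2, ← mul_rpow_threshold hα0]
    have := hz.1
    gcongr
  refine ⟨fun y hy => ?_, ?_, ?_⟩
  · have hypos : 0 < y := hy0'.trans_le hy.1
    rcases le_total y 1 with h1 | h1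
    · rw [hC y hypos h1]
      exact mul_nonpos_of_nonneg_of_nonpos hypos.le (hCneg y ⟨hy.1, h1⟩)
    rcases le_total y (α ^ (-p)) with h2 | h2
    · rw [hB y ⟨h1, h2⟩]
      exact mul_nonpos_of_nonneg_of_nonpos hypos.le (hBneg y ⟨h1, h2⟩)
    · rw [hA y h2]
      exact mul_nonpos_of_nonneg_of_nonpos hypos.le (hAneg y ⟨h2, hy.2⟩)
  · rw [hC ystar hy0' hy1.le, hCstar, mul_zero]
  · rw [hA y0 hay, hAy0, mul_zero]

end
end
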